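/- For all integers k, d ≥ 0 and c ≥ 1 there exists an integer ℓ ≥ 0 with the following property: for every finite simple graph G of path-width at most d and all sets S, T ⊆ V(G), either (i) there are k+1 paths of G between S and T, pairwise at distance at least c in G, or (ii) there is a set X ⊆ V(G) with |X| ≤ k such that every path of G between S and T contains a vertex at distance at most ℓ in G from some member of X. -/

import Mathlib

open SimpleGraph

/-- The distance in a graph `G` between two sets of vertices: the number of edges in a
shortest walk of `G` with one end in `A` and the other in `B` (`⊤` if no such walk exists). -/
noncomputable def eSetDist {V : Type*} (G : SimpleGraph V) (A B : Set V) : ℕ∞ :=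
  sInf {n : ℕ∞ | ∃ (a b : V) (w : G.Walk a b), a ∈ A ∧ b ∈ B ∧ (w.length : ℕ∞) = n}

/-- `G` has path-width at most `d`: there is a sequence `W 0, …, W (n-1)` of sets of vertices,
each of size at most `d+1`, whose induced subgraphs cover `G` (all vertices and all edges),
and satisfying the interpolation property `W i ∩ W l ⊆ W j` for `i ≤ j ≤ l`. -/
def PathwidthAtMost {V : Type*} (G : SimpleGraph V) (d : ℕ) : Prop :=
  ∃ (n : ℕ) (W : Fin n → Finset V),
    (∀ i, (W i).card ≤ d + 1) ∧
    (∀ v : V, ∃ i, v ∈ W i) ∧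
    (∀ u v : V, G.Adj u v → ∃ i, u ∈ W i ∧ v ∈ W i) ∧
    (∀ i j l : Fin n, i ≤ j → j ≤ l → ∀ v : V, v ∈ W i → v ∈ W l → v ∈ W j)


open SimpleGraph

set_option linter.unusedVariables false

namespace CM

def DK {V : Type} (G : SimpleGraph V) (X : Set V) (r : ℕ) (x y : V) : Prop :=
  ∃ w : G.Walk x y, w.length ≤ r ∧ ∀ z ∈ w.support, z ∈ X

def D {V : Type} (G : SimpleGraph V) (r : ℕ) (x y : V) : Prop := DK G Set.univ r x y

def Conn {V : Type} (G : SimpleGraph V) (X : Set V) : Prop :=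
  ∀ x ∈ X, ∀ y ∈ X, ∃ r, DK G X r x y

section basics
variable {V : Type} {G : SimpleGraph V} {X Y : Set V} {r s : ℕ} {x y z : V}

theorem DK.refl (hx : x ∈ X) : DK G X r x x :=
  ⟨Walk.nil, by simp, by simpa using hx⟩

theorem DK.symm (h : DK G X r x y) : DK G X r y x := by
  obtain ⟨w, h1, h2⟩ := h
  exact ⟨w.reverse, by simpa using h1, by simpa using h2⟩

theorem DK.trans (h : DK G X r x y) (h' : DK G X s y z) : DK G X (r + s) x z := by
  obtain ⟨w, h1, h2⟩ := h
  obtain ⟨w', h1', h2'⟩ := h'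
  refine ⟨w.append w', by rw [Walk.length_append]; omega, ?_⟩
  intro u hu
  rw [Walk.mem_support_append_iff] at hu
  rcases hu with hu | hu
  · exact h2 _ hu
  · exact h2' _ hu

theorem DK.mono (h : DK G X r x y) (hr : r ≤ s) (hX : X ⊆ Y) : DK G Y s x y := by
  obtain ⟨w, h1, h2⟩ := h
  exact ⟨w, by omega, fun z hz => hX (h2 z hz)⟩

theorem DK.left (h : DK G X r x y) : x ∈ X := by
  obtain ⟨w, h1, h2⟩ := h
  exact h2 _ w.start_mem_support

theorem DK.right (h : DK G X r x y) : y ∈ X := h.symm.left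

theorem DK.toD (h : DK G X r x y) : D G r x y := h.mono le_rfl (Set.subset_univ _)

theorem DK.adj (h : G.Adj x y) (hx : x ∈ X) (hy : y ∈ X) : DK G X 1 x y :=
  ⟨h.toWalk, by simp, by simp [hx, hy]⟩

theorem DK.zero (h : DK G X 0 x y) : x = y := by
  obtain ⟨w, h1, h2⟩ := h
  exact Walk.eq_of_length_eq_zero (p := w) (by omega)

theorem DK.step (h : DK G X (r + 1) x y) : x = y ∨ ∃ z, G.Adj x z ∧ z ∈ X ∧ DK G X r z y := by
  obtain ⟨w, h1, h2⟩ := h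
  cases w with
  | nil => left; rfl
  | cons hadj w =>
    right
    refine ⟨_, hadj, h2 _ (by simp), w, by simpa using h1, fun u hu => h2 _ (by simp [hu])⟩

theorem DK.split : ∀ {r : ℕ} {x : V}, DK G X (r + s) x y → ∃ z, DK G X r x z ∧ DK G X s z y := by
  intro r
  induction r with
  | zero =>
    intro x h
    rw [Nat.zero_add] at h
    exact ⟨x, DK.refl h.left, h⟩
  | succ r ih =>
    intro x h
    rw [Nat.add_right_comm] at h
    rcases h.step with rfl | ⟨z, h1, h2, h3⟩
    · exact ⟨x, DK.refl h.left, DK.refl h.left⟩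
    · obtain ⟨z', h4, h5⟩ := ih h3
      exact ⟨z', ((DK.adj h1 h.left h2).trans h4).mono (by omega) le_rfl, h5⟩

theorem D.refl : D G r x x := DK.refl (Set.mem_univ _)
theorem D.symm (h : D G r x y) : D G r y x := DK.symm h
theorem D.trans (h : D G r x y) (h' : D G s y z) : D G (r + s) x z := DK.trans h h'
theorem D.mono (h : D G r x y) (hr : r ≤ s) : D G s x y := DK.mono h hr le_rfl
theorem D.adj (h : G.Adj x y) : D G 1 x y := DK.adj h (Set.mem_univ _) (Set.mem_univ _)

theorem Conn.singleton : Conn G ({x} : Set V) := by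
  intro a ha b hb
  rw [Set.mem_singleton_iff] at ha hb
  subst ha; subst hb
  exact ⟨0, DK.refl rfl⟩

theorem Conn.of_center (hx : x ∈ X) (h : ∀ y ∈ X, ∃ r, DK G X r x y) : Conn G X := by
  intro a ha b hb
  obtain ⟨r, hr⟩ := h a ha
  obtain ⟨s, hs⟩ := h b hb
  exact ⟨r + s, hr.symm.trans hs⟩

theorem Conn.union (hX : Conn G X) (hY : Conn G Y) (h1 : z ∈ X) (h2 : z ∈ Y) :
    Conn G (X ∪ Y) := by
  apply Conn.of_center (x := z) (Or.inl h1)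
  rintro y (hy | hy)
  · obtain ⟨r, hr⟩ := hX z h1 y hy
    exact ⟨r, hr.mono le_rfl Set.subset_union_left⟩
  · obtain ⟨r, hr⟩ := hY z h2 y hy
    exact ⟨r, hr.mono le_rfl Set.subset_union_right⟩

theorem DK.prop {P : V → Prop} (hP : ∀ u v, u ∈ X → v ∈ X → G.Adj u v → P u → P v) :
    ∀ {r x y}, DK G X r x y → P x → P y := by
  intro r
  induction r with
  | zero => intro x y h hx; rw [← h.zero]; exact hx
  | succ r ih =>
    intro x y h hx
    rcases h.step with rfl | ⟨z, h1, h2, h3⟩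
    · exact hx
    · exact ih h3 (hP _ _ h.left h2 h1 hx)

theorem Conn.prop {P : V → Prop} (hX : Conn G X)
    (hP : ∀ u v, u ∈ X → v ∈ X → G.Adj u v → P u → P v) (hx : x ∈ X) (hy : y ∈ X) (h : P x) :
    P y := by
  obtain ⟨r, hr⟩ := hX x hx y hy
  exact hr.prop hP h

theorem DK.path : ∀ {r : ℕ} {x y : V}, DK G X r x y → ∃ S ⊆ X, x ∈ S ∧ y ∈ S ∧ Conn G S ∧
    ∀ z ∈ S, ∃ i j, i + j ≤ r ∧ DK G S i x z ∧ DK G S j z y := by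
  intro r
  induction r with
  | zero =>
    intro x y h
    have := h.zero
    subst this
    refine ⟨{x}, by simpa using h.left, rfl, rfl, Conn.singleton, ?_⟩
    rintro z rfl
    exact ⟨0, 0, le_rfl, DK.refl rfl, DK.refl rfl⟩
  | succ r ih =>
    intro x y h
    rcases h.step with rfl | ⟨z, h1, h2, h3⟩
    · refine ⟨{x}, by simpa using h.left, rfl, rfl, Conn.singleton, ?_⟩
      rintro z rfl
      exact ⟨0, 0, by omega, DK.refl rfl, DK.refl rfl⟩
    · obtain ⟨S, hS, hz, hy, hc, hd⟩ := ih h3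
      have hss : S ⊆ insert x S := Set.subset_insert _ _
      have hxz : DK G (insert x S) 1 x z := DK.adj h1 (Set.mem_insert _ _) (hss hz)
      have key : ∀ w ∈ insert x S, ∃ i j, i + j ≤ r + 1 ∧ DK G (insert x S) i x w ∧
          DK G (insert x S) j w y := by
        rintro w (rfl | hw)
        · obtain ⟨i, j, hij, ha, hb⟩ := hd z hz
          refine ⟨0, j + 1, by omega, DK.refl (Set.mem_insert _ _), ?_⟩
          exact (hxz.trans (hb.mono le_rfl hss)).mono (by omega) le_rfl
        · obtain ⟨i, j, hij, ha, hb⟩ := hd w hw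
          refine ⟨i + 1, j, by omega, ?_, hb.mono le_rfl hss⟩
          exact (hxz.trans (ha.mono le_rfl hss)).mono (by omega) le_rfl
      refine ⟨insert x S, Set.insert_subset h.left hS, Set.mem_insert _ _, hss hy,
        Conn.of_center (Set.mem_insert _ _) ?_, key⟩
      intro w hw
      obtain ⟨i, j, _, ha, _⟩ := key w hw
      exact ⟨i, ha⟩

end basics

def RS {V : Type} (G : SimpleGraph V) : ℕ → Set V → V → Prop
  | 0, T, v => v ∈ T ∧ Conn G T
  | n + 1, T, v => ∃ x1 x2 T1 T2 S1 S2, RS G n T1 x1 ∧ RS G n T2 x2 ∧ Disjoint T1 T2 ∧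
      Conn G S1 ∧ Conn G S2 ∧ v ∈ S1 ∧ x1 ∈ S1 ∧ v ∈ S2 ∧ x2 ∈ S2 ∧
      (∀ z ∈ S1, z ∉ T2) ∧ (∀ z ∈ S1, z ∈ T1 → z = x1) ∧
      (∀ z ∈ S2, z ∉ T1) ∧ (∀ z ∈ S2, z ∈ T2 → z = x2) ∧
      T = (T1 ∪ S1) ∪ (S2 ∪ T2)

section rs
variable {V : Type} {G : SimpleGraph V}

theorem RS.mem_conn : ∀ {n : ℕ} {T : Set V} {v : V}, RS G n T v → v ∈ T ∧ Conn G T := by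
  intro n
  induction n with
  | zero => intro T v h; exact h
  | succ n ih =>
    rintro T v ⟨x1, x2, T1, T2, S1, S2, h1, h2, hd, hc1, hc2, hv1, hx1, hv2, hx2, _, _, _, _, rfl⟩
    refine ⟨Or.inl (Or.inr hv1), ?_⟩
    exact ((ih h1).2.union hc1 (ih h1).1 hx1).union (hc2.union (ih h2).2 hx2 (ih h2).1)
      (z := v) (Or.inr hv1) (Or.inl hv2)

theorem conn_bag {n : ℕ} {W : Fin n → Finset V}
    (hE : ∀ u v : V, G.Adj u v → ∃ i, u ∈ W i ∧ v ∈ W i)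
    (hI : ∀ i j l : Fin n, i ≤ j → j ≤ l → ∀ v : V, v ∈ W i → v ∈ W l → v ∈ W j)
    {X : Set V} (hX : Conn G X) {a c : V} (ha : a ∈ X) (hc : c ∈ X) {i j l : Fin n}
    (hai : a ∈ W i) (hcl : c ∈ W l) (hij : i ≤ j) (hjl : j ≤ l) : ∃ x ∈ X, x ∈ W j := by
  by_contra hno
  push Not at hno
  have : ∃ m, c ∈ W m ∧ m < j := by
    refine hX.prop (P := fun x => ∃ m, x ∈ W m ∧ m < j) ?_ ha hc ⟨i, hai, ?_⟩
    · rintro u v hu hv huv ⟨m, hm, hmj⟩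
      obtain ⟨m', hu', hv'⟩ := hE u v huv
      refine ⟨m', hv', ?_⟩
      by_contra hcon
      exact hno u hu (hI m j m' hmj.le (not_lt.mp hcon) u hm hu')
    · refine lt_of_le_of_ne hij ?_
      rintro rfl
      exact hno a ha hai
  obtain ⟨m, hm, hmj⟩ := this
  exact hno c hc (hI m j l hmj.le hjl c hm hcl)

theorem RS.bag {n : ℕ} {W : Fin n → Finset V}
    (hV : ∀ v : V, ∃ i, v ∈ W i)
    (hE : ∀ u v : V, G.Adj u v → ∃ i, u ∈ W i ∧ v ∈ W i)
    (hI : ∀ i j l : Fin n, i ≤ j → j ≤ l → ∀ v : V, v ∈ W i → v ∈ W l → v ∈ W j) :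
    ∀ (p : ℕ) (T : Set V) (v : V), RS G (2 * p) T v →
      ∃ i, ∃ F : Finset V, F ⊆ W i ∧ (∀ x ∈ F, x ∈ T) ∧ F.card = p + 1 := by
  classical
  intro p
  induction p with
  | zero =>
    intro T v h
    obtain ⟨i, hi⟩ := hV v
    exact ⟨i, {v}, by simpa using hi, by simpa using h.1, by simp⟩
  | succ p ih =>
    intro T v h
    have e : 2 * (p + 1) = (2 * p + 1) + 1 := by ring
    rw [e] at h
    obtain ⟨x1, x2, T1, T2, S1, S2, h1, h2, hd, hc1, hc2, hv1, hx1, hv2, hx2, a1, a2, a3, a4, rfl⟩ := h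
    have m1 := h1.mem_conn
    have m2 := h2.mem_conn
    obtain ⟨x11, x12, T11, T12, S11, S12, h11, h12, hd', hc11, hc12, hv11, hx11, hv12, hx12,
      b1, b2, b3, b4, e1⟩ := h1
    obtain ⟨x21, x22, T21, T22, S21, S22, h21, h22, hd2', _, _, _, _, _, _,
      _, _, _, _, e2⟩ := h2
    have sA : T11 ⊆ T1 := by rw [e1]; intro z hz; exact Or.inl (Or.inl hz)
    have sB : T12 ⊆ T1 := by rw [e1]; intro z hz; exact Or.inr (Or.inr hz)
    have sS11 : S11 ⊆ T1 := by rw [e1]; intro z hz; exact Or.inl (Or.inr hz)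
    have sS12 : S12 ⊆ T1 := by rw [e1]; intro z hz; exact Or.inr (Or.inl hz)
    have sC : T21 ⊆ T2 := by rw [e2]; intro z hz; exact Or.inl (Or.inl hz)
    have n11 := h11.mem_conn
    have n12 := h12.mem_conn
    have n21 := h21.mem_conn
    obtain ⟨a, FA, fa1, fa2, fa3⟩ := ih _ _ h11
    obtain ⟨b, FB, fb1, fb2, fb3⟩ := ih _ _ h12
    obtain ⟨c, FC, fc1, fc2, fc3⟩ := ih _ _ h21
    have ext : ∀ (i m l : Fin n) (F F1 F2 : Finset V) (Md Q : Set V), F ⊆ W m → (∀ x ∈ F, x ∈ Md) →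
        F.card = p + 1 → Conn G Q → (∀ z ∈ Q, z ∉ Md) → Q ⊆ (T1 ∪ S1) ∪ (S2 ∪ T2) →
        Md ⊆ (T1 ∪ S1) ∪ (S2 ∪ T2) → F1 ⊆ W i → (∀ x ∈ F1, x ∈ Q) → F1.card = p + 1 →
        F2 ⊆ W l → (∀ x ∈ F2, x ∈ Q) → F2.card = p + 1 → (i ≤ m ∧ m ≤ l ∨ l ≤ m ∧ m ≤ i) →
        ∃ i, ∃ F : Finset V, F ⊆ W i ∧ (∀ x ∈ F, x ∈ (T1 ∪ S1) ∪ (S2 ∪ T2)) ∧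
          F.card = p + 1 + 1 := by
      intro i m l F F1 F2 Md Q hF hFM hFc hQ hQM hQT hMT hF1 hF1Q hF1c hF2 hF2Q hF2c hord
      obtain ⟨y1, hy1⟩ : F1.Nonempty := Finset.card_pos.mp (by omega)
      obtain ⟨y2, hy2⟩ : F2.Nonempty := Finset.card_pos.mp (by omega)
      obtain ⟨x, hxQ, hxW⟩ : ∃ x ∈ Q, x ∈ W m := by
        rcases hord with ⟨o1, o2⟩ | ⟨o1, o2⟩
        · exact conn_bag hE hI hQ (hF1Q _ hy1) (hF2Q _ hy2) (hF1 hy1) (hF2 hy2) o1 o2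
        · exact conn_bag hE hI hQ (hF2Q _ hy2) (hF1Q _ hy1) (hF2 hy2) (hF1 hy1) o1 o2
      refine ⟨m, insert x F, Finset.insert_subset hxW hF, ?_, ?_⟩
      · intro z hz
        rcases Finset.mem_insert.mp hz with rfl | hz
        · exact hQT hxQ
        · exact hMT (hFM _ hz)
      · rw [Finset.card_insert_of_notMem, hFc]
        intro hx
        exact hQM x hxQ (hFM x hx)
    have disj : ∀ z, z ∈ T1 → z ∈ T2 → False := fun z p q => Set.disjoint_left.mp hd p q
    have disj' : ∀ z, z ∈ T11 → z ∈ T12 → False := fun z p q => Set.disjoint_left.mp hd' p q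
    have mA : (a ≤ c ∧ c ≤ b ∨ b ≤ c ∧ c ≤ a) ∨ (a ≤ b ∧ b ≤ c ∨ c ≤ b ∧ b ≤ a) ∨
        (b ≤ a ∧ a ≤ c ∨ c ≤ a ∧ a ≤ b) := by omega
    have sT : ∀ X : Set V, X ⊆ T1 → X ⊆ (T1 ∪ S1) ∪ (S2 ∪ T2) :=
      fun X hX z hz => Or.inl (Or.inl (hX hz))
    rcases mA with hord | hord | hord
    · refine ext a c b FC FA FB T21 T1 fc1 fc2 fc3 m1.2 ?_ (sT _ le_rfl) ?_ fa1 ?_ fa3 fb1 ?_ fb3 hord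
      · intro z hz hz'; exact disj z hz (sC hz')
      · intro z hz; exact Or.inr (Or.inr (sC hz))
      · intro x hx; exact sA (fa2 x hx)
      · intro x hx; exact sB (fb2 x hx)
    · have hQ : Conn G (((T11 ∪ S11) ∪ S1) ∪ (S2 ∪ T2)) :=
        ((n11.2.union hc11 n11.1 hx11).union hc1 (Or.inr hv11) hx1).union
          (hc2.union m2.2 hx2 m2.1) (z := v) (Or.inr hv1) (Or.inl hv2)
      refine ext a b c FB FA FC T12 _ fb1 fb2 fb3 hQ ?_ ?_ (sT _ sB) fa1 ?_ fa3 fc1 ?_ fc3 hord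
      · rintro z (((hz | hz) | hz) | (hz | hz)) hz'
        · exact disj' z hz hz'
        · exact b1 z hz hz'
        · have := a2 z hz (sB hz')
          subst this
          exact b1 _ hv11 hz'
        · exact a3 z hz (sB hz')
        · exact disj z (sB hz') hz
      · rintro z (((hz | hz) | hz) | (hz | hz))
        · exact sT _ sA hz
        · exact sT _ sS11 hz
        · exact Or.inl (Or.inr hz)
        · exact Or.inr (Or.inl hz)
        · exact Or.inr (Or.inr hz)
      · intro x hx; exact Or.inl (Or.inl (Or.inl (fa2 x hx)))
      · intro x hx; exact Or.inr (Or.inr (sC (fc2 x hx)))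
    · have hQ : Conn G (((T12 ∪ S12) ∪ S1) ∪ (S2 ∪ T2)) :=
        ((n12.2.union hc12 n12.1 hx12).union hc1 (Or.inr hv12) hx1).union
          (hc2.union m2.2 hx2 m2.1) (z := v) (Or.inr hv1) (Or.inl hv2)
      refine ext b a c FA FB FC T11 _ fa1 fa2 fa3 hQ ?_ ?_ (sT _ sA) fb1 ?_ fb3 fc1 ?_ fc3 hord
      · rintro z (((hz | hz) | hz) | (hz | hz)) hz'
        · exact disj' z hz' hz
        · exact b3 z hz hz'
        · have := a2 z hz (sA hz')
          subst this
          exact b3 _ hv12 hz'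
        · exact a3 z hz (sA hz')
        · exact disj z (sA hz') hz
      · rintro z (((hz | hz) | hz) | (hz | hz))
        · exact sT _ sB hz
        · exact sT _ sS12 hz
        · exact Or.inl (Or.inr hz)
        · exact Or.inr (Or.inl hz)
        · exact Or.inr (Or.inr hz)
      · intro x hx; exact Or.inl (Or.inl (Or.inl (fb2 x hx)))
      · intro x hx; exact Or.inr (Or.inr (sC (fc2 x hx)))

end rs

def Good {V : Type} (G : SimpleGraph V) (K : Set V) (q : ℕ) (v : V) (n : ℕ) : Prop :=
  ∃ T, RS G n T v ∧ ∀ y ∈ T, DK G K (q * n) v y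

def Inv {V : Type} (G : SimpleGraph V) (q N : ℕ) (A K : Set V) : Prop :=
  A ⊆ K ∧ ∀ v ∈ K, ∀ n < N, (∀ w ∈ A, ¬ DK G K (q * n) v w) → Good G K q v (n + 1)

section hull
variable {V : Type} {G : SimpleGraph V} {q N : ℕ} {A K : Set V}

theorem Good.mono {K' : Set V} {v : V} {n : ℕ} (h : Good G K q v n) (hK : K ⊆ K') :
    Good G K' q v n := by
  obtain ⟨T, h1, h2⟩ := h
  exact ⟨T, h1, fun y hy => (h2 y hy).mono le_rfl hK⟩

theorem Inv.self : Inv G q N A A :=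
  ⟨le_rfl, fun v hv n _ h => absurd (DK.refl hv) (h v hv)⟩

theorem Inv.add {Nw : Set V} (h : Inv G q N A K) : Inv G q N (A ∪ Nw) (K ∪ Nw) := by
  refine ⟨Set.union_subset_union_left _ h.1, ?_⟩
  rintro v (hv | hv) n hn hA
  · refine (h.2 v hv n hn ?_).mono Set.subset_union_left
    intro w hw hd
    exact hA w (Or.inl hw) (hd.mono le_rfl Set.subset_union_left)
  · exact (hA v (Or.inr hv) (DK.refl (Set.mem_union_right _ hv))).elim

theorem Inv.pathGood (h : Inv G q N A K) {K' : Set V} (hK : K ⊆ K') {x v : V} (hx : x ∈ K)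
    {n i : ℕ} (hn : n < N)
    (hA : ∀ w ∈ A, ¬ DK G K' (q * n) v w) (hi : i ≤ q) (hvx : DK G K' i v x) :
    Good G K q x n := by
  cases n with
  | zero =>
    refine ⟨{x}, ⟨rfl, Conn.singleton⟩, ?_⟩
    rintro y rfl
    exact DK.refl hx
  | succ n =>
    refine h.2 x hx n (by omega) ?_
    intro w hw hd
    refine hA w hw ((hvx.trans (hd.mono le_rfl hK)).mono ?_ le_rfl)
    rw [mul_add]; omega

theorem hull [Finite V] {B : Set V} (hN : ∀ T v, ¬ RS G N T v) (hN0 : 0 < N) (h : Inv G q N A B) :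
    ∃ K, B ⊆ K ∧ Inv G q N A K ∧
      (∀ x ∈ K, ∀ y ∈ K, ∀ δ ≤ q, D G δ x y → DK G K ((2 * q * N + 1) * δ) x y) ∧
      (∀ v ∈ K, ∃ w ∈ A, DK G K (q * N) v w) := by
  classical
  obtain ⟨K, ⟨hBK, hK⟩, hmax⟩ : ∃ K, Maximal (fun K : Set V => B ⊆ K ∧ Inv G q N A K) K :=
    (Set.toFinite {K : Set V | B ⊆ K ∧ Inv G q N A K}).exists_maximal ⟨B, le_rfl, h⟩
  refine ⟨K, hBK, hK, ?_, ?_⟩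
  · set lam := 2 * q * N + 1 with hlam
    by_contra hcon
    have hex : ∃ δ, ∃ x ∈ K, ∃ y ∈ K, δ ≤ q ∧ D G δ x y ∧ ¬ DK G K (lam * δ) x y := by
      push Not at hcon
      obtain ⟨x, hx, y, hy, δ, h1, h2, h3⟩ := hcon
      exact ⟨δ, x, hx, y, hy, h1, h2, h3⟩
    obtain ⟨x, hx, y, hy, h1, h2, h3⟩ := Nat.find_spec hex
    have hmin : ∀ δ' < Nat.find hex, ∀ x ∈ K, ∀ y ∈ K, D G δ' x y → DK G K (lam * δ') x y := by
      intro δ' hδ' x' hx' y' hy' hD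
      by_contra hcon
      exact Nat.find_min hex hδ' ⟨x', hx', y', hy', by omega, hD, hcon⟩
    set δ := Nat.find hex
    have hδ0 : δ ≠ 0 := by
      intro h0
      rw [h0] at h2 h3
      have := h2.zero
      subst this
      exact h3 (DK.refl hx)
    obtain ⟨S, -, hxS, hyS, hcS, hS⟩ := DK.path h2
    have hint : ∀ z ∈ S, z ∈ K → z = x ∨ z = y := by
      intro z hz hzK
      by_contra hne
      push Not at hne
      obtain ⟨i, j, hij, hi, hj⟩ := hS z hz
      have hi0 : i ≠ 0 := by
        rintro rfl
        exact hne.1 hi.zero.symm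
      have hj0 : j ≠ 0 := by
        rintro rfl
        exact hne.2 hj.zero
      have a1 := hmin i (by omega) x hx z hzK hi.toD
      have a2 := hmin j (by omega) z hzK y hy hj.toD
      refine h3 ((a1.trans a2).mono ?_ le_rfl)
      rw [← mul_add]
      exact Nat.mul_le_mul_left _ hij
    have hKS : K ⊆ K ∪ S := Set.subset_union_left
    have hSS : S ⊆ K ∪ S := Set.subset_union_right
    have hInv : Inv G q N A (K ∪ S) := by
      refine ⟨hK.1.trans hKS, ?_⟩
      intro v hv n hn hA
      by_cases hvK : v ∈ K
      · refine (hK.2 v hvK n hn ?_).mono hKS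
        intro w hw hd
        exact hA w hw (hd.mono le_rfl hKS)
      · have hvS : v ∈ S := hv.resolve_left hvK
        obtain ⟨i, j, hij, hi, hj⟩ := hS v hvS
        obtain ⟨Tx, rx, dx⟩ := hK.pathGood hKS hx hn hA (i := i) (by omega)
          (hi.symm.mono le_rfl hSS)
        obtain ⟨Ty, ry, dy⟩ := hK.pathGood hKS hy hn hA (i := j) (by omega)
          (hj.mono le_rfl hSS)
        have hdis : ∀ z, z ∈ Tx → z ∈ Ty → False := by
          intro z hz hz'
          refine h3 (((dx z hz).trans (dy z hz').symm).mono ?_ le_rfl)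
          have : q * n ≤ q * N := Nat.mul_le_mul_left _ hn.le
          have h4 : lam * 1 ≤ lam * δ := Nat.mul_le_mul_left _ (by omega)
          have h5 : 2 * q * N = 2 * (q * N) := by ring
          omega
        obtain ⟨S1, s1S, vS1, xS1, cS1, dS1⟩ := DK.path hi.symm
        obtain ⟨S2, s2S, vS2, yS2, cS2, dS2⟩ := DK.path hj
        have hxTx := rx.mem_conn.1
        have hyTy := ry.mem_conn.1
        have hxi : y ∉ S1 := by
          intro hy1
          obtain ⟨i', j', hij', hi', hj'⟩ := dS1 y hy1
          have : DK G K (lam * j') y x := by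
            by_cases hc : j' < δ
            · exact hmin j' hc y hy x hx hj'.toD
            · have : i' = 0 := by omega
              subst this
              exact absurd (hi'.zero ▸ hy) hvK
          refine h3 (this.symm.mono (Nat.mul_le_mul_left _ (by omega)) le_rfl)
        have hyi : x ∉ S2 := by
          intro hy1
          obtain ⟨i', j', hij', hi', hj'⟩ := dS2 x hy1
          have : DK G K (lam * j') x y := by
            by_cases hc : j' < δ
            · exact hmin j' hc x hx y hy hj'.toD
            · have : i' = 0 := by omega
              subst this
              exact absurd (hi'.zero ▸ hx) hvK
          refine h3 (this.mono (Nat.mul_le_mul_left _ (by omega)) le_rfl)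
        refine ⟨(Tx ∪ S1) ∪ (S2 ∪ Ty), ⟨x, y, Tx, Ty, S1, S2, rx, ry, ?_, cS1, cS2, vS1, xS1, vS2,
          yS2, ?_, ?_, ?_, ?_, rfl⟩, ?_⟩
        · exact Set.disjoint_left.mpr (fun z a b => hdis z a b)
        · intro z hz hz'
          rcases hint z (s1S hz) (dy z hz').right with rfl | rfl
          · exact hdis z hxTx hz'
          · exact hxi hz
        · intro z hz hz'
          rcases hint z (s1S hz) (dx z hz').right with rfl | rfl
          · rfl
          · exact absurd hz hxi
        · intro z hz hz'
          rcases hint z (s2S hz) (dx z hz').right with rfl | rfl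
          · exact hyi hz
          · exact hdis z hz' hyTy
        · intro z hz hz'
          rcases hint z (s2S hz) (dy z hz').right with rfl | rfl
          · exact absurd hz hyi
          · rfl
        · have hmul : q * (n + 1) = q * n + q := by ring
          rintro z ((hz | hz) | (hz | hz))
          · exact ((hi.symm.mono le_rfl hSS).trans ((dx z hz).mono le_rfl hKS)).mono
              (by omega) le_rfl
          · obtain ⟨i', j', hij', hi', hj'⟩ := dS1 z hz
            exact hi'.mono (by omega) (s1S.trans hSS)
          · obtain ⟨i', j', hij', hi', hj'⟩ := dS2 z hz
            exact hi'.mono (by omega) (s2S.trans hSS)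
          · exact ((hj.mono le_rfl hSS).trans ((dy z hz).mono le_rfl hKS)).mono
              (by omega) le_rfl
    have hle : K ∪ S ⊆ K := hmax ⟨hBK.trans hKS, hInv⟩ hKS
    obtain ⟨i, j, hij, hi, hj⟩ := hS x hxS
    refine h3 ((hj.mono (s := lam * δ) ?_ (hSS.trans hle)))
    have h4 : 1 * δ ≤ lam * δ := Nat.mul_le_mul_right _ (by omega)
    omega
  · intro v hv
    by_contra hcon
    push Not at hcon
    obtain ⟨m, rfl⟩ : ∃ m, N = m + 1 := ⟨N - 1, by omega⟩
    obtain ⟨T, hT, -⟩ := hK.2 v hv m (by omega) (fun w hw hd => hcon w hw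
      (hd.mono (Nat.mul_le_mul_left _ (by omega)) le_rfl))
    exact hN T v hT

end hull

end CM
open SimpleGraph
set_option linter.unusedVariables false
namespace CM

theorem complete {V : Type} {G : SimpleGraph V} {q N : ℕ} [Finite V]
    (hN : ∀ T v, ¬ RS G N T v) (hN0 : 0 < N) (A K Nw : Set V) (T : V → ℕ) (Src : V → ℕ → Prop)
    (hInv : Inv G q N A K) (hSK : ∀ v ∈ K, Src v (T v)) :
    ∃ (A' K' : Set V) (T' : V → ℕ), K ⊆ K' ∧ A' ⊆ A ∪ Nw ∧ Inv G q N A' K' ∧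
      (∀ x ∈ K', ∀ y ∈ K', ∀ δ ≤ q, D G δ x y → DK G K' ((2 * q * N + 1) * δ) x y) ∧
      (∀ v ∈ K', ∃ w ∈ A', DK G K' (q * N) v w) ∧
      (∀ x y r, DK G K' r x y → T' y ≤ T' x + r) ∧
      (∀ u ∈ K', ∀ τ, Src u τ → T' u ≤ τ) ∧
      (∀ u ∈ Nw, ∀ τ, Src u τ → u ∈ K') ∧
      (∀ v ∈ K', ∀ v' ∈ Nw, G.Adj v v' → v' ∈ K') ∧
      (∀ v ∈ K', ∃ u ∈ K', ∃ τ, Src u τ ∧ ∃ Sw ⊆ K', Conn G Sw ∧ u ∈ Sw ∧ v ∈ Sw ∧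
        ∀ x ∈ Sw, τ ≤ T' x ∧ T' x ≤ T' v) := by
  classical
  obtain ⟨H, hBH, hI, hcl, hnear⟩ := hull (B := K ∪ Nw) hN hN0 (hInv.add (Nw := Nw))
  let K' : Set V := {v | ∃ u τ r, Src u τ ∧ DK G H r u v}
  have hK'H : K' ⊆ H := by
    rintro v ⟨u, τ, r, _, h⟩
    exact h.right
  have hstep : ∀ v ∈ K', ∀ r y, DK G H r v y → y ∈ K' := by
    rintro v ⟨u, τ, r, h1, h2⟩ s y hy
    exact ⟨u, τ, r + s, h1, h2.trans hy⟩
  have hDK : ∀ v ∈ K', ∀ r y, DK G H r v y → DK G K' r v y := by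
    intro v hv r y hy
    obtain ⟨w, hw, hs⟩ := hy
    refine ⟨w, hw, ?_⟩
    intro z hz
    refine hstep v hv (w.takeUntil z hz).length z ⟨w.takeUntil z hz, le_rfl, ?_⟩
    intro z' hz'
    exact hs z' (w.support_takeUntil_subset_support hz hz')
  let T' : V → ℕ := fun v => sInf {n | ∃ u τ r, Src u τ ∧ DK G H r u v ∧ n = τ + r}
  have hT'1 : ∀ v u τ r, Src u τ → DK G H r u v → T' v ≤ τ + r :=
    fun v u τ r h1 h2 => Nat.sInf_le ⟨u, τ, r, h1, h2, rfl⟩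
  have hT'2 : ∀ v ∈ K', ∃ u τ r, Src u τ ∧ DK G H r u v ∧ T' v = τ + r := by
    rintro v ⟨u, τ, r, h1, h2⟩
    exact Nat.sInf_mem (s := {n | ∃ u τ r, Src u τ ∧ DK G H r u v ∧ n = τ + r})
      ⟨_, u, τ, r, h1, h2, rfl⟩
  have hLip : ∀ x y r, DK G K' r x y → T' y ≤ T' x + r := by
    intro x y r h
    obtain ⟨u, τ, s, h1, h2, h3⟩ := hT'2 x h.left
    have := hT'1 y u τ (s + r) h1 (h2.trans (h.mono le_rfl hK'H))
    omega
  have hsrcK : ∀ u ∈ H, ∀ τ, Src u τ → u ∈ K' := fun u hu τ h => ⟨u, τ, 0, h, DK.refl hu⟩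
  refine ⟨(A ∪ Nw) ∩ K', K', T', ?_, Set.inter_subset_left, ⟨Set.inter_subset_right, ?_⟩, ?_, ?_,
    hLip, ?_, ?_, ?_, ?_⟩
  · intro v hv
    exact hsrcK v (hBH (Or.inl hv)) _ (hSK v hv)
  · intro v hv n hn hA
    obtain ⟨Y, h1, h2⟩ := hI.2 v (hK'H hv) n hn (by
      intro w hw hd
      have := hDK v hv _ _ hd
      exact hA w ⟨hw, this.right⟩ this)
    exact ⟨Y, h1, fun y hy => hDK v hv _ _ (h2 y hy)⟩
  · intro x hx y hy δ hδ hd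
    exact hDK x hx _ _ (hcl x (hK'H hx) y (hK'H hy) δ hδ hd)
  · intro v hv
    obtain ⟨w, hw, hd⟩ := hnear v (hK'H hv)
    have := hDK v hv _ _ hd
    exact ⟨w, ⟨hw, this.right⟩, this⟩
  · intro u hu τ h
    have := hT'1 u u τ 0 h (DK.refl (hK'H hu))
    omega
  · intro u hu τ h
    exact hsrcK u (hBH (Or.inr hu)) τ h
  · intro v hv v' hv' hadj
    exact hstep v hv 1 v' (DK.adj hadj (hK'H hv) (hBH (Or.inr hv')))
  · intro v hv
    obtain ⟨u, τ, r, h1, h2, h3⟩ := hT'2 v hv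
    have huK : u ∈ K' := hsrcK u h2.left τ h1
    obtain ⟨Sw, hSw, hu, hv', hc, hd⟩ := DK.path (hDK u huK r v h2)
    refine ⟨u, huK, τ, h1, Sw, hSw, hc, hu, hv', ?_⟩
    intro x hx
    obtain ⟨i, j, hij, hi, hj⟩ := hd x hx
    have a1 := hLip x v j (hj.mono le_rfl hSw)
    have a2 := hT'1 x u τ i h1 (hi.mono le_rfl (hSw.trans hK'H))
    constructor <;> omega

end CM
open SimpleGraph
set_option linter.unusedVariables false
namespace CM

structure Env (V : Type) (k : ℕ) where
  G : SimpleGraph V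
  S : Set V
  Tg : Set V
  p : Fin k → ℕ → V
  n : Fin k → ℕ
  (c N h L1 β W RU' RU R1 RE R RF Rfar q1 Λ : ℕ)
  hN : ∀ T v, ¬ RS G N T v
  hN0 : 0 < N
  iL1 : (2 * (4 * c) * N + 1) * (4 * c) ≤ L1
  ih : (4 * c) * N ≤ h
  iβ1 : L1 < β
  iβ2 : h < β
  iW : h + 2 * c ≤ W
  iRU' : h + 2 * c + 1 ≤ RU'
  iRU : RU' + h + 1 ≤ RU
  iR1 : W + RU ≤ R1
  iRE : R1 + 1 ≤ RE
  iR : h + RE + c + 1 ≤ R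
  iRF : W + R + 1 ≤ RF
  iRfar : R + 1 + RE + 2 * c ≤ Rfar
  iq1 : 2 * Rfar + RE + 2 * R + W + RU + 10 ≤ q1
  iΛ : 1 ≤ Λ
  radj : ∀ i t, t < n i → G.Adj (p i t) (p i (t + 1))
  rS : ∀ i, p i 0 ∈ S
  rT : ∀ i, p i (n i) ∈ Tg
  tidy : ∀ i t t', t + Λ ≤ t' → t' ≤ n i → ¬ D G q1 (p i t) (p i t')
  sep : ∀ i j t t', i ≠ j → t ≤ n i → t' ≤ n j → ¬ D G q1 (p i t) (p j t')

structure Dat (V : Type) (k : ℕ) where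
  ρ : Fin k → ℕ
  K : Set V
  A : Set V
  T : V → ℕ
  lam : Fin k → ℕ → ℕ
  Cn : Fin k → Set V
  σ : Fin k → ℕ
  M : ℕ

variable {V : Type} {k : ℕ}

theorem Env.ap (E : Env V k) {i j : Fin k} {t t' : ℕ} (h : i ≠ j ∨ t + E.Λ ≤ t' ∨ t' + E.Λ ≤ t)
    (ht : t ≤ E.n i) (ht' : t' ≤ E.n j) : ¬ D E.G E.q1 (E.p i t) (E.p j t') := by
  by_cases hij : i = j
  · subst hij
    rcases h with h | h | h
    · exact absurd rfl h
    · exact E.tidy i t t' h ht'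
    · intro hd; exact E.tidy i t' t h ht hd.symm
  · exact E.sep i j t t' hij ht ht'

/-- near one row vertex, far from another -/
theorem Env.ap2 (E : Env V k) {i j : Fin k} {t t' : ℕ} {a : V} {r s : ℕ}
    (hd : D E.G r a (E.p i t)) (hd' : D E.G s a (E.p j t')) (hrs : r + s ≤ E.q1)
    (ht : t ≤ E.n i) (ht' : t' ≤ E.n j)
    (h : i ≠ j ∨ t + E.Λ ≤ t' ∨ t' + E.Λ ≤ t) : False :=
  E.ap h ht ht' ((hd.symm.trans hd').mono hrs)

theorem Env.ap3 (E : Env V k) {i j : Fin k} {t t' : ℕ} {r s : ℕ} {a : V}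
    (hd : D E.G r a (E.p i t)) (hd' : D E.G s a (E.p j t')) (hrs : r + s ≤ E.q1)
    (ht : t ≤ E.n i) (ht' : t' ≤ E.n j) : i = j ∧ t < t' + E.Λ ∧ t' < t + E.Λ := by
  by_contra hcon
  refine E.ap2 hd hd' hrs ht ht' ?_
  by_cases hij : i = j
  · right
    have : ¬ (t < t' + E.Λ ∧ t' < t + E.Λ) := fun hh => hcon ⟨hij, hh⟩
    omega
  · exact Or.inl hij

def Seg (E : Env V k) (i : Fin k) (s t : ℕ) : Set V := {a | ∃ u, s ≤ u ∧ u ≤ t ∧ a = E.p i u}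

theorem Env.rowD (E : Env V k) (i : Fin k) (t : ℕ) : ∀ s, t + s ≤ E.n i →
    DK E.G (Seg E i t (t + s)) s (E.p i t) (E.p i (t + s)) := by
  intro s
  induction s with
  | zero => intro h; exact DK.refl ⟨t, le_rfl, le_rfl, rfl⟩
  | succ s ih =>
    intro h
    have h1 := ih (by omega)
    have h2 := E.radj i (t + s) (by omega)
    refine (h1.mono le_rfl ?_).trans (DK.adj h2 ⟨t + s, by omega, by omega, rfl⟩
      ⟨t + s + 1, by omega, by omega, rfl⟩)
    rintro a ⟨u, h1, h2, rfl⟩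
    exact ⟨u, h1, by omega, rfl⟩

theorem Env.segConn (E : Env V k) (i : Fin k) {s t : ℕ} (hst : s ≤ t) (ht : t ≤ E.n i) :
    Conn E.G (Seg E i s t) := by
  refine Conn.of_center (x := E.p i s) ⟨s, le_rfl, hst, rfl⟩ ?_
  rintro y ⟨u, h1, h2, rfl⟩
  obtain ⟨v, rfl⟩ := Nat.exists_eq_add_of_le h1
  refine ⟨v, (E.rowD i s v (by omega)).mono le_rfl ?_⟩
  rintro a ⟨w, h3, h4, rfl⟩
  exact ⟨w, h3, by omega, rfl⟩

theorem Env.rowD' (E : Env V k) (i : Fin k) {t t' r : ℕ} (ht : t ≤ E.n i) (ht' : t' ≤ E.n i)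
    (h1 : t ≤ t' + r) (h2 : t' ≤ t + r) : D E.G r (E.p i t) (E.p i t') := by
  rcases le_total t t' with h | h
  · obtain ⟨s, rfl⟩ := Nat.exists_eq_add_of_le h
    exact (E.rowD i t s ht').toD.mono (by omega)
  · obtain ⟨s, rfl⟩ := Nat.exists_eq_add_of_le h
    exact (E.rowD i t' s ht).toD.symm.mono (by omega)

def Grd (E : Env V k) (X : Dat V k) (a : V) (γ : ℕ) : Prop :=
  (a ∈ X.K ∧ X.T a + E.L1 < γ) ∨
  (∃ i, a ∈ X.Cn i ∧ X.σ i + E.L1 < γ ∧ X.σ i + E.h < γ ∧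
    ∀ w ∈ X.A, D E.G E.W w a → X.T w + E.h < γ) ∨
  (∃ j t, t + E.Λ ≤ X.ρ j ∧ D E.G E.RU a (E.p j t) ∧
    ∀ w ∈ X.A, D E.G E.W w a → X.T w + E.h < γ) ∨
  (∃ j t, t + 2 * E.Λ ≤ X.ρ j ∧ ∃ u ∈ X.K, ∃ r1 r2, r1 + r2 ≤ E.RE ∧
    D E.G r1 (E.p j t) a ∧ D E.G r2 a u ∧ X.lam j t + E.L1 < γ)

theorem Grd.mono {E : Env V k} {X : Dat V k} {a : V} {γ γ' : ℕ} (h : Grd E X a γ) (hg : γ ≤ γ') :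
    Grd E X a γ' := by
  rcases h with ⟨h1, h2⟩ | ⟨i, h1, h2, h3, h4⟩ | ⟨j, t, h1, h2, h3⟩ |
    ⟨j, t, h1, u, hu, r1, r2, h2, h3, h4, h5⟩
  · exact Or.inl ⟨h1, by omega⟩
  · exact Or.inr (Or.inl ⟨i, h1, by omega, by omega, fun w hw hd => by have := h4 w hw hd; omega⟩)
  · exact Or.inr (Or.inr (Or.inl ⟨j, t, h1, h2, fun w hw hd => by have := h3 w hw hd; omega⟩))
  · exact Or.inr (Or.inr (Or.inr ⟨j, t, h1, u, hu, r1, r2, h2, h3, h4, by omega⟩))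

def Row (E : Env V k) (a : V) : Prop := ∃ i t, t ≤ E.n i ∧ a = E.p i t

structure Sys (E : Env V k) (X : Dat V k) (τ : ℕ) (θ : Fin k → ℕ) (C : Set V) (H : Fin k → Set V)
    (b : Fin k → ℕ) : Prop where
  hconn : ∀ i, Conn E.G (H i)
  hS : ∀ i, ∃ s ∈ E.S, s ∈ H i
  hb : ∀ i, E.p i (b i) ∈ H i
  hbρ : ∀ i, b i ≤ X.ρ i
  cH : ∀ a ∈ C, ∀ i, ∀ a' ∈ H i, ¬ D E.G E.c a a'
  cR : ∀ a ∈ C, ∀ i t, b i ≤ t → t ≤ E.n i → ¬ D E.G E.c a (E.p i t)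
  HH : ∀ i j, i ≠ j → ∀ a ∈ H i, ∀ a' ∈ H j, ¬ D E.G E.c a a'
  HR : ∀ i j, i ≠ j → ∀ a ∈ H i, ∀ t, b j ≤ t → t ≤ E.n j → ¬ D E.G E.c a (E.p j t)
  gH : ∀ i, ∀ a ∈ H i, Row E a ∨ Grd E X a τ
  gC : ∀ a ∈ C, Row E a ∨ Grd E X a (X.M + E.β)
  clC : ∀ a ∈ C, a ∈ X.K ∨ ∀ j t, X.ρ j < t + E.Λ → θ j ≤ t → t ≤ E.n j →
    ¬ D E.G E.Rfar a (E.p j t)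
  clH : ∀ i j, i ≠ j → ∀ a ∈ H i, a ∈ X.K ∨ ∀ t, X.ρ j < t + E.Λ → t ≤ E.n j →
    ¬ D E.G E.Rfar a (E.p j t)
  clHH : ∀ j, ∀ a ∈ H j, a ∈ X.K ∨ ∀ t, X.ρ j + E.Λ ≤ t → t ≤ E.n j →
    ¬ D E.G E.Rfar a (E.p j t)

theorem Sys.persist {E : Env V k} {X X' : Dat V k} {τ τ' : ℕ} {θ θ' : Fin k → ℕ} {C : Set V}
    {H : Fin k → Set V} {b : Fin k → ℕ} (h : Sys E X τ θ C H b) (hK : X.K ⊆ X'.K)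
    (hρ : ∀ i, X.ρ i ≤ X'.ρ i) (hM : X.M ≤ X'.M) (hG : ∀ a γ, Grd E X a γ → Grd E X' a γ)
    (hτ : τ ≤ τ') (hθ : ∀ i t, X'.ρ i < t + E.Λ → θ' i ≤ t → θ i ≤ t) :
    Sys E X' τ' θ' C H b where
  hconn := h.hconn
  hS := h.hS
  hb := h.hb
  hbρ i := (h.hbρ i).trans (hρ i)
  cH := h.cH
  cR := h.cR
  HH := h.HH
  HR := h.HR
  gH i a ha := (h.gH i a ha).imp id (fun hh => (hG _ _ hh).mono hτ)
  gC a ha := (h.gC a ha).imp id (fun hh => (hG _ _ hh).mono (by omega))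
  clC a ha := (h.clC a ha).imp (fun hh => hK hh)
    (fun hh j t h1 h2 h3 => hh j t (by have := hρ j; omega) (hθ j t h1 h2) h3)
  clH i j hij a ha := (h.clH i j hij a ha).imp (fun hh => hK hh)
    (fun hh t h1 h2 => hh t (by have := hρ j; omega) h2)
  clHH j a ha := (h.clHH j a ha).imp (fun hh => hK hh)
    (fun hh t h1 h2 => hh t (by have := hρ j; omega) h2)

def FarZ (E : Env V k) (z : V) (H : Fin k → Set V) (b : Fin k → ℕ) : Prop :=
  (∀ i, ∀ a ∈ H i, ¬ D E.G (E.RE + E.c) z a) ∧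
  (∀ i t, b i ≤ t → t ≤ E.n i → ¬ D E.G (E.RE + E.c) z (E.p i t))

def HasSys (E : Env V k) (X : Dat V k) (v : V) (τ : ℕ) (θ : Fin k → ℕ) : Prop :=
  ∃ C H b, Sys E X τ θ C H b ∧ v ∈ C ∧ Conn E.G C ∧ ∃ s ∈ E.S, s ∈ C

def HasSysZ (E : Env V k) (X : Dat V k) (v : V) (τ : ℕ) (θ : Fin k → ℕ) : Prop :=
  ∃ C H b, Sys E X τ θ C H b ∧ v ∈ C ∧ Conn E.G C ∧ (∃ s ∈ E.S, s ∈ C) ∧ FarZ E v H b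

def thZ (E : Env V k) (j : Fin k) (t : ℕ) : Fin k → ℕ := fun i => if i = j then t + E.Λ else 0

structure Pre (E : Env V k) (X : Dat V k) : Prop where
  ρn : ∀ i, X.ρ i ≤ E.n i
  inv : Inv E.G (4 * E.c) E.N X.A X.K
  TM : ∀ v ∈ X.K, X.T v ≤ X.M
  lamM : ∀ j t, X.lam j t ≤ X.M
  σM : ∀ j, X.σ j ≤ X.M
  a1 : ∀ w ∈ X.A, ∀ i t, t ≤ E.n i → ¬ D E.G E.RU' w (E.p i t)
  a2 : ∀ w ∈ X.A, ∀ i t, t ≤ E.n i → X.ρ i < t + 2 * E.Λ → ¬ D E.G E.R w (E.p i t)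
  sysK : ∀ v ∈ X.K, HasSys E X v (X.T v) (fun _ => 0)
  sysZ : ∀ j t, t + E.Λ ≤ X.ρ j → HasSysZ E X (E.p j t) (X.lam j t) (thZ E j t)
  cn1 : ∀ i, ∀ a ∈ X.Cn i, D E.G (E.R + 1) a (E.p i (X.ρ i))
  cn2 : ∀ i, ∀ a ∈ X.Cn i, ¬ D E.G E.RU a (E.p i (X.ρ i)) →
    (∀ l t, t ≤ E.n l → ¬ D E.G E.RU' a (E.p l t)) ∧ HasSys E X a (X.σ i) (thZ E i (X.ρ i))

def Out (E : Env V k) (ρ : Fin k → ℕ) : Set V :=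
  {v | (∀ i t, t ≤ E.n i → ¬ D E.G E.R1 v (E.p i t)) ∧
    (∀ i t, t ≤ E.n i → ρ i < t + 2 * E.Λ → ¬ D E.G E.R v (E.p i t)) ∧
    (∀ i, ¬ D E.G E.RF v (E.p i (ρ i)))}

structure Cls (E : Env V k) (X : Dat V k) : Prop where
  cl : ∀ x ∈ X.K, ∀ y ∈ X.K, D E.G (4 * E.c) x y → DK E.G X.K E.L1 x y
  near : ∀ v ∈ X.K, ∃ w ∈ X.A, DK E.G X.K E.h v w
  lip : ∀ x y r, DK E.G X.K r x y → X.T y ≤ X.T x + r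
  entry : ∀ u ∈ X.K, ∀ j t, t + 2 * E.Λ ≤ X.ρ j → D E.G E.RE u (E.p j t) → X.T u ≤ X.lam j t

structure Full (E : Env V k) (X : Dat V k) : Prop extends Pre E X, Cls E X where
  f7a : ∀ s ∈ E.S, s ∈ Out E X.ρ → s ∈ X.K
  f7b : ∀ v ∈ X.K, ∀ v' ∈ Out E X.ρ, E.G.Adj v v' → v' ∈ X.K
  f7c : ∀ v ∈ Out E X.ρ, ∀ j t, t + 2 * E.Λ ≤ X.ρ j → D E.G E.RE v (E.p j t) → v ∈ X.K

theorem Cls.grd {E : Env V k} {X : Dat V k} (hX : Cls E X) {a x : V} {γ : ℕ} (h : Grd E X a γ)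
    (hx : x ∈ X.K) (hd : D E.G (2 * E.c) x a) : X.T x < γ := by
  have iW := E.iW
  have near : (∀ w ∈ X.A, D E.G E.W w a → X.T w + E.h < γ) → X.T x < γ := by
    intro hw
    obtain ⟨w, hwA, hwd⟩ := hX.near x hx
    have h1 := hw w hwA ((hwd.toD.symm.trans hd).mono iW)
    have h2 := hX.lip w x _ hwd.symm
    omega
  rcases h with ⟨h1, h2⟩ | ⟨i, h1, h2, h3, h4⟩ | ⟨j, t, h1, h2, h3⟩ |
    ⟨j, t, h1, u, hu, r1, r2, h2, h3, h4, h5⟩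
  · have := hX.lip a x _ (hX.cl a h1 x hx (hd.symm.mono (by omega)))
    omega
  · exact near h4
  · exact near h3
  · by_cases hr : r2 ≤ 2 * E.c
    · have a1 := hX.lip u x _ (hX.cl u hu x hx ((h4.symm.trans hd.symm).mono (by omega)))
      have a2 := hX.entry u hu j t h1 ((h4.symm.trans h3.symm).mono (by omega))
      omega
    · have a2 := hX.entry x hx j t h1 ((hd.trans h3.symm).mono (by omega))
      omega

/-- points of K are far from rows -/
theorem farK {E : Env V k} {X : Dat V k} (hX : Cls E X)
    (a1 : ∀ w ∈ X.A, ∀ i t, t ≤ E.n i → ¬ D E.G E.RU' w (E.p i t)) {x : V} (hx : x ∈ X.K)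
    {i t r} (hr : r ≤ 2 * E.c + 1) (ht : t ≤ E.n i) : ¬ D E.G r x (E.p i t) := by
  intro hd
  obtain ⟨w, hwA, hwd⟩ := hX.near x hx
  have := E.iRU'
  exact a1 w hwA i t ht ((hwd.toD.symm.trans hd).mono (by omega))

theorem Full.farR {E : Env V k} {X : Dat V k} (hX : Full E X) {x : V} (hx : x ∈ X.K)
    {i t r} (hr : r + E.h ≤ E.R) (ht : t ≤ E.n i) (h : X.ρ i < t + 2 * E.Λ) :
    ¬ D E.G r x (E.p i t) := by
  intro hd
  obtain ⟨w, hwA, hwd⟩ := hX.near x hx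
  exact hX.a2 w hwA i t ht h ((hwd.toD.symm.trans hd).mono (by omega))

end CM
open SimpleGraph
set_option linter.unusedVariables false
namespace CM
variable {V : Type} {k : ℕ}

theorem sys_base (E : Env V k) (X : Dat V k) (τ : ℕ) (θ : Fin k → ℕ) :
    Sys E X τ θ ∅ (fun i => {E.p i 0}) (fun _ => 0) := by
  have iq1 := E.iq1
  have iRfar := E.iRfar
  refine ⟨fun i => Conn.singleton, fun i => ⟨_, E.rS i, rfl⟩, fun i => rfl, fun i => Nat.zero_le _,
    by simp, by simp, ?_, ?_, ?_, by simp, by simp, ?_, ?_⟩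
  · rintro i j hij a rfl a' rfl hd
    exact E.sep i j 0 0 hij (Nat.zero_le _) (Nat.zero_le _) (hd.mono (by omega))
  · rintro i j hij a rfl t - ht hd
    exact E.sep i j 0 t hij (Nat.zero_le _) ht (hd.mono (by omega))
  · rintro i a rfl
    exact Or.inl ⟨i, 0, Nat.zero_le _, rfl⟩
  · rintro i j hij a rfl
    right
    intro t _ ht hd
    exact E.sep i j 0 t hij (Nat.zero_le _) ht (hd.mono (by omega))
  · rintro j a rfl
    right
    intro t h ht hd
    exact E.tidy j 0 t (by omega) ht (hd.mono (by omega))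

theorem Sys.addC {E : Env V k} {X : Dat V k} {τ : ℕ} {θ : Fin k → ℕ} {C : Set V}
    {H : Fin k → Set V} {b : Fin k → ℕ} (h : Sys E X τ θ C H b) {Q : Set V}
    (q1 : ∀ a ∈ Q, ∀ i, ∀ a' ∈ H i, ¬ D E.G E.c a a')
    (q2 : ∀ a ∈ Q, ∀ i t, b i ≤ t → t ≤ E.n i → ¬ D E.G E.c a (E.p i t))
    (q3 : ∀ a ∈ Q, Row E a ∨ Grd E X a (X.M + E.β))
    (q4 : ∀ a ∈ Q, a ∈ X.K ∨ ∀ j t, X.ρ j < t + E.Λ → θ j ≤ t → t ≤ E.n j →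
      ¬ D E.G E.Rfar a (E.p j t)) : Sys E X τ θ (C ∪ Q) H b where
  hconn := h.hconn
  hS := h.hS
  hb := h.hb
  hbρ := h.hbρ
  cH := by rintro a (ha | ha); exacts [h.cH a ha, q1 a ha]
  cR := by rintro a (ha | ha); exacts [h.cR a ha, q2 a ha]
  HH := h.HH
  HR := h.HR
  gH := h.gH
  gC := by rintro a (ha | ha); exacts [h.gC a ha, q3 a ha]
  clC := by rintro a (ha | ha); exacts [h.clC a ha, q4 a ha]
  clH := h.clH
  clHH := h.clHH

theorem HasSys.persist {E : Env V k} {X X' : Dat V k} {v : V} {τ τ' : ℕ} {θ θ' : Fin k → ℕ}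
    (h : HasSys E X v τ θ) (hK : X.K ⊆ X'.K)
    (hρ : ∀ i, X.ρ i ≤ X'.ρ i) (hM : X.M ≤ X'.M) (hG : ∀ a γ, Grd E X a γ → Grd E X' a γ)
    (hτ : τ ≤ τ') (hθ : ∀ i t, X'.ρ i < t + E.Λ → θ' i ≤ t → θ i ≤ t) : HasSys E X' v τ' θ' := by
  obtain ⟨C, H, b, h1, h2⟩ := h
  exact ⟨C, H, b, h1.persist hK hρ hM hG hτ hθ, h2⟩

theorem HasSysZ.persist {E : Env V k} {X X' : Dat V k} {v : V} {τ τ' : ℕ} {θ θ' : Fin k → ℕ}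
    (h : HasSysZ E X v τ θ) (hK : X.K ⊆ X'.K)
    (hρ : ∀ i, X.ρ i ≤ X'.ρ i) (hM : X.M ≤ X'.M) (hG : ∀ a γ, Grd E X a γ → Grd E X' a γ)
    (hτ : τ ≤ τ') (hθ : ∀ i t, X'.ρ i < t + E.Λ → θ' i ≤ t → θ i ≤ t) : HasSysZ E X' v τ' θ' := by
  obtain ⟨C, H, b, h1, h2⟩ := h
  exact ⟨C, H, b, h1.persist hK hρ hM hG hτ hθ, h2⟩

/-- Adding to the C of a system of a departure-left row vertex a geodesic of length `≤ RE`. -/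
theorem geo_far {E : Env V k} {z : V} {H : Fin k → Set V} {b : Fin k → ℕ} (h : FarZ E z H b)
    {a : V} (ha : D E.G E.RE z a) : (∀ i, ∀ a' ∈ H i, ¬ D E.G E.c a a') ∧
    ∀ i t, b i ≤ t → t ≤ E.n i → ¬ D E.G E.c a (E.p i t) :=
  ⟨fun i a' ha' hd => h.1 i a' ha' (ha.trans hd), fun i t h1 h2 hd => h.2 i t h1 h2 (ha.trans hd)⟩

theorem completion [Finite V] {E : Env V k} {X : Dat V k} (hX : Pre E X) :
    ∃ X', X'.ρ = X.ρ ∧ Full E X' := by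
  classical
  obtain ⟨A', K', T', hKK, hAA, hInv, hcl, hnear, hlip, hsrc, hNwS, hNwA, htr⟩ :=
    complete E.hN E.hN0 X.A X.K (Out E X.ρ) X.T
      (fun u τ => (u ∈ X.K ∧ τ = X.T u) ∨ (u ∈ E.S ∧ τ = 0) ∨
        ∃ j t, t + 2 * E.Λ ≤ X.ρ j ∧ D E.G E.RE u (E.p j t) ∧ τ = X.lam j t)
      hX.inv (fun v hv => Or.inl ⟨hv, rfl⟩)
  have iL1 := E.iL1
  have ih := E.ih
  have iβ1 := E.iβ1
  have iβ2 := E.iβ2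
  have iW := E.iW
  have iRU' := E.iRU'
  have iRU := E.iRU
  have iR1 := E.iR1
  have iRE := E.iRE
  have iR := E.iR
  have iRF := E.iRF
  have iRfar := E.iRfar
  have iq1 := E.iq1
  have iΛ := E.iΛ
  obtain ⟨M0, hM0⟩ : ∃ M0, ∀ v, T' v ≤ M0 := by
    haveI := Fintype.ofFinite V
    exact ⟨Finset.univ.sup T', fun v => Finset.le_sup (Finset.mem_univ v)⟩
  set X' : Dat V k := ⟨X.ρ, K', A', T', X.lam, X.Cn, X.σ, max X.M M0⟩ with hX'
  have hTT : ∀ v ∈ X.K, T' v ≤ X.T v := fun v hv => hsrc v (hKK hv) _ (Or.inl ⟨hv, rfl⟩)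
  have hMM : X.M ≤ X'.M := le_max_left _ _
  have hG : ∀ a γ, Grd E X a γ → Grd E X' a γ := by
    intro a γ h
    rcases h with ⟨h1, h2⟩ | ⟨i, h1, h2, h3, h4⟩ | ⟨j, t, h1, h2, h3⟩ |
      ⟨j, t, h1, u, hu, r1, r2, h2, h3, h4, h5⟩
    · refine Or.inl ⟨hKK h1, ?_⟩
      have := hTT a h1
      show T' a + _ < _
      omega
    · refine Or.inr (Or.inl ⟨i, h1, h2, h3, ?_⟩)
      intro w hw hd
      rcases hAA hw with hw | hw
      · have := h4 w hw hd
        have := hTT w (hX.inv.1 hw)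
        show T' w + _ < _
        omega
      · exact absurd ((hd.trans (hX.cn1 i a h1)).mono (by omega)) (hw.2.2 i)
    · refine Or.inr (Or.inr (Or.inl ⟨j, t, h1, h2, ?_⟩))
      intro w hw hd
      rcases hAA hw with hw | hw
      · have := h3 w hw hd
        have := hTT w (hX.inv.1 hw)
        show T' w + _ < _
        omega
      · exact absurd ((hd.trans h2).mono (by omega)) (hw.1 j t (by have := hX.ρn j; omega))
    · exact Or.inr (Or.inr (Or.inr ⟨j, t, h1, u, hKK hu, r1, r2, h2, h3, h4, h5⟩))
  have hCls : Cls E X' := by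
    refine ⟨?_, ?_, hlip, ?_⟩
    · intro x hx y hy hd
      exact (hcl x hx y hy _ le_rfl hd).mono iL1 le_rfl
    · intro v hv
      obtain ⟨w, hw, hd⟩ := hnear v hv
      exact ⟨w, hw, hd.mono ih le_rfl⟩
    · intro u hu j t ht hd
      exact hsrc u hu _ (Or.inr (Or.inr ⟨j, t, ht, hd, rfl⟩))
  have ha1 : ∀ w ∈ X'.A, ∀ i t, t ≤ E.n i → ¬ D E.G E.RU' w (E.p i t) := by
    intro w hw i t ht hd
    rcases hAA hw with hw | hw
    · exact hX.a1 w hw i t ht hd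
    · exact hw.1 i t ht (hd.mono (by omega))
  have hTM : ∀ v ∈ X'.K, X'.T v ≤ X'.M := fun v _ => (hM0 v).trans (le_max_right _ _)
  have hgK : ∀ v ∈ X'.K, Grd E X' v (X'.M + E.β) := by
    intro v hv
    refine Or.inl ⟨hv, ?_⟩
    have := hTM v hv
    omega
  -- every source has a system
  have hS : ∀ u ∈ K', ∀ τ, ((u ∈ X.K ∧ τ = X.T u) ∨ (u ∈ E.S ∧ τ = 0) ∨
        ∃ j t, t + 2 * E.Λ ≤ X.ρ j ∧ D E.G E.RE u (E.p j t) ∧ τ = X.lam j t) →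
        HasSys E X' u τ (fun _ => 0) := by
    rintro u hu τ (⟨h1, rfl⟩ | ⟨h1, rfl⟩ | ⟨j, t, ht, hd, rfl⟩)
    · exact (hX.sysK u h1).persist hKK (fun _ => le_rfl) hMM hG le_rfl (fun _ _ _ h => h)
    · refine ⟨∅ ∪ {u}, _, _, (sys_base E X' 0 _).addC (Q := {u}) ?_ ?_ ?_ ?_, Or.inr rfl, ?_, u, h1,
        Or.inr rfl⟩
      · rintro a rfl i a' rfl
        exact farK hCls ha1 hu (by omega) (Nat.zero_le _)
      · rintro a rfl i t _ ht
        exact farK hCls ha1 hu (by omega) ht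
      · rintro a rfl
        exact Or.inr (hgK _ hu)
      · rintro a rfl
        exact Or.inl hu
      · rw [Set.empty_union]; exact Conn.singleton
    · obtain ⟨C, H, b, h1, h2, h3, ⟨s, h4, h4'⟩, h5⟩ := hX.sysZ j t (by omega)
      obtain ⟨Q, -, hzQ, huQ, hcQ, hQ⟩ := DK.path hd.symm
      have hQR : ∀ a ∈ Q, D E.G E.RE (E.p j t) a := by
        intro a ha
        obtain ⟨i1, i2, hi, hi1, hi2⟩ := hQ a ha
        exact hi1.toD.mono (by omega)
      have hρ := hX.ρn j
      have h1' : Sys E X' (X.lam j t) (fun _ => 0) C H b := by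
        refine h1.persist hKK (fun _ => le_rfl) hMM hG le_rfl ?_
        intro i t' h6 _
        have h6 : X.ρ i < t' + E.Λ := h6
        unfold thZ
        split_ifs with hij
        · subst hij; omega
        · omega
      refine ⟨C ∪ Q, H, b, h1'.addC ?_ ?_ ?_ ?_, Or.inr huQ, h3.union hcQ h2 hzQ, s, h4, Or.inl h4'⟩
      · intro a ha
        exact (geo_far h5 (hQR a ha)).1
      · intro a ha
        exact (geo_far h5 (hQR a ha)).2
      · intro a ha
        right
        obtain ⟨i1, i2, hi, hi1, hi2⟩ := hQ a ha
        refine Or.inr (Or.inr (Or.inr ⟨j, t, ht, u, hu, i1, i2, hi, hi1.toD, hi2.toD, ?_⟩))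
        have := hX.lamM j t
        show X.lam j t + _ < _
        omega
      · intro a ha
        right
        intro i t' h6 _ h7 hd'
        have h6 : X.ρ i < t' + E.Λ := h6
        refine E.ap2 (hQR a ha).symm hd' (by omega) (by omega) h7 ?_
        by_cases hij : j = i
        · subst hij; right; left; omega
        · exact Or.inl hij
  have hPre : Pre E X' := by
    refine ⟨hX.ρn, hInv, hTM, fun j t => (hX.lamM j t).trans hMM, fun j => (hX.σM j).trans hMM,
      ha1, ?_, ?_, ?_, hX.cn1, ?_⟩
    · intro w hw i t ht h hd
      rcases hAA hw with hw | hw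
      · exact hX.a2 w hw i t ht h hd
      · exact hw.2.1 i t ht h hd
    · intro v hv
      obtain ⟨u, hu, τ, hsr, Sw, hSw, hc, huS, hvS, hlab⟩ := htr v hv
      obtain ⟨C, H, b, h1, h2, h3, s, h4, h4'⟩ := hS u hu τ hsr
      have h1' : Sys E X' (T' v) (fun _ => 0) C H b :=
        h1.persist le_rfl (fun _ => le_rfl) le_rfl (fun _ _ h => h)
          ((hlab u huS).1.trans (hlab u huS).2) (fun _ _ _ h => h)
      refine ⟨C ∪ Sw, H, b, h1'.addC ?_ ?_ ?_ ?_, Or.inr hvS, h3.union hc h2 huS, s, h4, Or.inl h4'⟩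
      · intro x hx i a ha hd
        rcases h1.gH i a ha with ⟨l, t, ht, rfl⟩ | hg
        · exact farK hCls ha1 (hSw hx) (by omega) ht hd
        · have h6 := hCls.grd hg (hSw hx) (hd.mono (by omega))
          have h7 := (hlab x hx).1
          have h6 : T' x < τ := h6
          omega
      · intro x hx i t _ ht
        exact farK hCls ha1 (hSw hx) (by omega) ht
      · intro x hx
        exact Or.inr (hgK x (hSw hx))
      · intro x hx
        exact Or.inl (hSw hx)
    · intro j t ht
      exact (hX.sysZ j t ht).persist hKK (fun _ => le_rfl) hMM hG le_rfl (fun _ _ _ h => h)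
    · intro i a ha hup
      refine ⟨(hX.cn2 i a ha hup).1, ?_⟩
      exact (hX.cn2 i a ha hup).2.persist hKK (fun _ => le_rfl) hMM hG le_rfl (fun _ _ _ h => h)
  refine ⟨X', rfl, ⟨hPre, hCls, ?_, ?_, ?_⟩⟩
  · intro s hs hO
    exact hNwS s hO 0 (Or.inr (Or.inl ⟨hs, rfl⟩))
  · intro v hv v' hv' hadj
    exact hNwA v hv v' hv' hadj
  · intro v hv j t ht hd
    exact hNwS v hv _ (Or.inr (Or.inr ⟨j, t, ht, hd, rfl⟩))

end CM
open SimpleGraph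
set_option linter.unusedVariables false
namespace CM
variable {V : Type} {k : ℕ}

structure Land (E : Env V k) (X : Dat V k) (j : Fin k) (τ T0 : ℕ) (Cv Q : Set V)
    (H : Fin k → Set V) (b : Fin k → ℕ) : Prop where
  hτ : X.ρ j + 3 * E.Λ ≤ τ
  hτn : τ ≤ E.n j
  hT0 : T0 ≤ X.M
  sys : Sys E X T0 (fun _ => 0) Cv H b
  hy : E.p j τ ∈ Q
  conn : Conn E.G (Cv ∪ Q)
  meet : ∃ s ∈ E.S, s ∈ Cv ∪ Q
  hQ : ∀ a ∈ Q, D E.G (E.R + 1) a (E.p j τ)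
  hQH : ∀ a ∈ Q, ∀ i, ∀ a' ∈ H i, ¬ D E.G E.c a a'
  upper : ∀ a ∈ Q, ¬ D E.G E.RU a (E.p j τ) → ∃ Q' ⊆ Q, a ∈ Q' ∧ Conn E.G (Cv ∪ Q') ∧
    (∃ s ∈ E.S, s ∈ Cv ∪ Q') ∧ ∀ a' ∈ Q', ∀ l t, t ≤ E.n l → ¬ D E.G E.RU' a' (E.p l t)

theorem landing {E : Env V k} {X : Dat V k} (hX : Full E X) {j : Fin k} {τ T0 : ℕ} {Cv Q : Set V}
    {H : Fin k → Set V} {b : Fin k → ℕ} (hL : Land E X j τ T0 Cv Q H b) :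
    ∃ X', X'.ρ = Function.update X.ρ j τ ∧ Pre E X' := by
  classical
  have iβ1 := E.iβ1
  have iβ2 := E.iβ2
  have iW := E.iW
  have iRU' := E.iRU'
  have iRU := E.iRU
  have iR1 := E.iR1
  have iRE := E.iRE
  have iR := E.iR
  have iRF := E.iRF
  have iRfar := E.iRfar
  have iq1 := E.iq1
  have iΛ := E.iΛ
  have hτ := hL.hτ
  have hτn := hL.hτn
  have hT0 := hL.hT0
  have Sv := hL.sys
  have hρn := hX.ρn j
  have hbj := Sv.hbρ j
  set Pend : Set V := {a | a ∈ X.Cn j ∧ ¬ D E.G E.RU a (E.p j (X.ρ j))} with hPend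
  set T1 : V → ℕ := fun v => if v ∈ Pend then (if v ∈ X.K then min (X.T v) (X.σ j) else X.σ j)
    else X.T v with hT1
  set X' : Dat V k := ⟨Function.update X.ρ j τ, X.K ∪ Pend, X.A ∪ Pend, T1,
    fun i t => if i = j ∧ X.ρ j < t + E.Λ then X.M + E.β else X.lam i t,
    Function.update X.Cn j Q, Function.update X.σ j X.M, X.M + E.β⟩ with hX'
  have ρj : X'.ρ j = τ := by simp [hX']
  have ρi : ∀ i, i ≠ j → X'.ρ i = X.ρ i := fun i hi => by simp [hX', hi]
  have Cj : X'.Cn j = Q := by simp [hX']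
  have Ci : ∀ i, i ≠ j → X'.Cn i = X.Cn i := fun i hi => by simp [hX', hi]
  have σj : X'.σ j = X.M := by simp [hX']
  have σi : ∀ i, i ≠ j → X'.σ i = X.σ i := fun i hi => by simp [hX', hi]
  have hM' : X'.M = X.M + E.β := rfl
  have lamj : ∀ t, X.ρ j < t + E.Λ → X'.lam j t = X.M + E.β := fun t ht => by simp [hX', ht]
  have lamo : ∀ i t, t + E.Λ ≤ X.ρ i → X'.lam i t = X.lam i t := by
    intro i t ht
    have : ¬ (i = j ∧ X.ρ j < t + E.Λ) := by
      rintro ⟨rfl, h⟩; omega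
    simp [hX', this]
  have hρρ : ∀ i, X.ρ i ≤ X'.ρ i := by
    intro i
    by_cases hi : i = j
    · subst hi; omega
    · rw [ρi i hi]
  have hKK : X.K ⊆ X'.K := Set.subset_union_left
  have hMM : X.M ≤ X'.M := by omega
  have hTT : ∀ v ∈ X.K, X'.T v ≤ X.T v := by
    intro v hv
    show T1 v ≤ _
    simp only [hT1, hv, if_true]
    split_ifs
    · exact min_le_left _ _
    · exact le_rfl
  have hTP : ∀ v ∈ Pend, X'.T v ≤ X.σ j := by
    intro v hv
    show T1 v ≤ _
    simp only [hT1, hv, if_true]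
    split_ifs
    · exact min_le_right _ _
    · exact le_rfl
  have hTc : ∀ v ∈ X'.K, (v ∈ X.K ∧ X'.T v = X.T v) ∨ (v ∈ Pend ∧ X'.T v = X.σ j) := by
    intro v hv
    by_cases hP : v ∈ Pend
    · by_cases hK : v ∈ X.K
      · have : X'.T v = min (X.T v) (X.σ j) := by
          show T1 v = _
          simp only [hT1, hP, hK, if_true]
        rcases min_choice (X.T v) (X.σ j) with h | h
        · left; exact ⟨hK, by rw [this, h]⟩
        · right; exact ⟨hP, by rw [this, h]⟩
      · right
        refine ⟨hP, ?_⟩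
        show T1 v = _
        simp only [hT1, hP, hK, if_true, if_false]
    · left
      refine ⟨hv.resolve_right hP, ?_⟩
      show T1 v = _
      simp only [hT1, hP, if_false]
  have hPnear : ∀ a ∈ Pend, D E.G (E.R + 1) a (E.p j (X.ρ j)) := fun a ha => hX.cn1 j a ha.1
  have hG : ∀ a γ, Grd E X a γ → Grd E X' a γ := by
    intro a γ h
    rcases h with ⟨h1, h2⟩ | ⟨i, h1, h2, h3, h4⟩ | ⟨l, t, h1, h2, h3⟩ |
      ⟨l, t, h1, u, hu, r1, r2, h2, h3, h4, h5⟩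
    · refine Or.inl ⟨hKK h1, ?_⟩
      have := hTT a h1
      omega
    · by_cases hij : i = j
      · subst hij
        by_cases hup : D E.G E.RU a (E.p i (X.ρ i))
        · refine Or.inr (Or.inr (Or.inl ⟨i, X.ρ i, by omega, hup, ?_⟩))
          rintro w (hw | hw) hd
          · have := h4 w hw hd
            have := hTT w (hX.inv.1 hw)
            omega
          · have := hTP w hw
            omega
        · have ha : a ∈ Pend := ⟨h1, hup⟩
          refine Or.inl ⟨Or.inr ha, ?_⟩
          have := hTP a ha
          omega
      · refine Or.inr (Or.inl ⟨i, ?_, ?_, ?_, ?_⟩)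
        · rw [Ci i hij]; exact h1
        · rw [σi i hij]; exact h2
        · rw [σi i hij]; exact h3
        · rintro w (hw | hw) hd
          · have := h4 w hw hd
            have := hTT w (hX.inv.1 hw)
            omega
          · exfalso
            exact E.ap2 (hPnear w hw) (hd.trans (hX.cn1 i a h1)) (by omega) hρn (hX.ρn i)
              (Or.inl (Ne.symm hij))
    · refine Or.inr (Or.inr (Or.inl ⟨l, t, h1.trans (hρρ l), h2, ?_⟩))
      rintro w (hw | hw) hd
      · have := h3 w hw hd
        have := hTT w (hX.inv.1 hw)
        omega
      · exfalso
        refine E.ap2 (hPnear w hw) (hd.trans h2) (by omega) hρn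
          (by have := hX.ρn l; omega) ?_
        by_cases hij : j = l
        · subst hij; right; right; exact h1
        · exact Or.inl hij
    · refine Or.inr (Or.inr (Or.inr ⟨l, t, h1.trans (hρρ l), u, hKK hu, r1, r2, h2, h3, h4, ?_⟩))
      rw [lamo l t (by omega)]
      exact h5
  have hfarK : ∀ x ∈ X.K, ∀ i t, t ≤ E.n i → ¬ D E.G E.c x (E.p i t) := fun x hx i t ht =>
    farK hX.toCls hX.a1 hx (by omega) ht
  -- guard of connector points
  have hgQ : ∀ a ∈ Q, Grd E X' a (X.M + E.β) := by
    intro a ha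
    refine Or.inr (Or.inl ⟨j, ?_, ?_, ?_, ?_⟩)
    · rw [Cj]; exact ha
    · rw [σj]; omega
    · rw [σj]; omega
    · rintro w (hw | hw) hd
      · have := hTT w (hX.inv.1 hw)
        have := hX.TM w (hX.inv.1 hw)
        omega
      · exfalso
        exact E.ap2 (hPnear w hw) (hd.trans (hL.hQ a ha)) (by omega) hρn hτn
          (Or.inr (Or.inl (by omega)))
  have Sv' : Sys E X' T0 (fun _ => 0) Cv H b :=
    Sv.persist hKK hρρ hMM hG le_rfl (fun _ _ _ h => h)
  refine ⟨X', rfl, ⟨?_, hX.inv.add, ?_, ?_, ?_, ?_, ?_, ?_, ?_, ?_, ?_⟩⟩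
  · intro i
    by_cases hi : i = j
    · subst hi; omega
    · rw [ρi i hi]; exact hX.ρn i
  · intro v hv
    rcases hTc v hv with ⟨h1, h2⟩ | ⟨h1, h2⟩
    · have := hX.TM v h1; omega
    · have := hX.σM j; omega
  · intro i t
    show (if _ then _ else _) ≤ _
    split_ifs
    · exact le_rfl
    · exact (hX.lamM i t).trans hMM
  · intro i
    by_cases hi : i = j
    · subst hi; omega
    · rw [σi i hi]; exact (hX.σM i).trans hMM
  · rintro w (hw | hw) i t ht
    · exact hX.a1 w hw i t ht
    · exact (hX.cn2 j w hw.1 hw.2).1 i t ht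
  · rintro w (hw | hw) i t ht h
    · exact hX.a2 w hw i t ht (lt_of_le_of_lt (hρρ i) h)
    · intro hd
      refine E.ap2 (hPnear w hw) hd (by omega) hρn ht ?_
      by_cases hij : j = i
      · subst hij; right; left; omega
      · exact Or.inl hij
  · -- sysK
    intro v hv
    rcases hTc v hv with ⟨h1, h2⟩ | ⟨h1, h2⟩
    · rw [h2]
      exact (hX.sysK v h1).persist hKK hρρ hMM hG le_rfl (fun _ _ _ h => h)
    · rw [h2]
      refine (hX.cn2 j v h1.1 h1.2).2.persist hKK hρρ hMM hG le_rfl ?_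
      intro i t h _
      unfold thZ
      split_ifs with hij
      · subst hij; omega
      · omega
  · -- sysZ
    intro i t ht
    by_cases hnew : i = j ∧ X.ρ j < t + E.Λ
    swap
    · have ht' : t + E.Λ ≤ X.ρ i := by
        by_cases hi : i = j
        · subst hi
          by_contra hcon
          exact hnew ⟨rfl, by omega⟩
        · rwa [ρi i hi] at ht
      rw [lamo i t ht']
      exact (hX.sysZ i t ht').persist hKK hρρ hMM hG le_rfl (fun _ _ _ h => h)
    · obtain ⟨rfl, htn⟩ := hnew
      rw [lamj t htn]
      rw [ρj] at ht
      have mH : ∀ l a, a ∈ (Function.update H i (Cv ∪ Q)) l → (l = i ∧ a ∈ Cv ∪ Q) ∨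
          (l ≠ i ∧ a ∈ H l) := by
        intro l a ha
        by_cases hl : l = i
        · subst hl; rw [Function.update_self] at ha; exact Or.inl ⟨rfl, ha⟩
        · rw [Function.update_of_ne hl] at ha; exact Or.inr ⟨hl, ha⟩
      have mb : ∀ l t, (Function.update b i τ) l ≤ t → (l = i ∧ τ ≤ t ∧ b i ≤ t) ∨
          (l ≠ i ∧ b l ≤ t) := by
        intro l t ha
        by_cases hl : l = i
        · subst hl; rw [Function.update_self] at ha; exact Or.inl ⟨rfl, ha, by omega⟩
        · rw [Function.update_of_ne hl] at ha; exact Or.inr ⟨hl, ha⟩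
      have mseg : ∀ a ∈ Seg E i (min t (b i)) (max t (b i)), ∃ u, a = E.p i u ∧ u + E.Λ ≤ τ ∧
          u ≤ E.n i ∧ (b i ≤ u ∨ X.ρ i < u + E.Λ) ∧ (u ≤ t ∨ u ≤ X.ρ i) := by
        rintro a ⟨u, h1, h2, rfl⟩
        refine ⟨u, rfl, ?_, ?_, ?_, ?_⟩ <;> omega
      have qap : ∀ a ∈ Q, ∀ l t', t' ≤ E.n l → (i ≠ l ∨ τ + E.Λ ≤ t' ∨ t' + E.Λ ≤ τ) →
          ∀ r, r ≤ E.Rfar → ¬ D E.G r a (E.p l t') := fun a ha l t' h1 h2 r hr hd =>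
        E.ap2 (hL.hQ a ha) hd (by omega) hτn h1 h2
      have F1 : ∀ a ∈ Cv, ∀ u, u ≤ E.n i → (b i ≤ u ∨ X.ρ i < u + E.Λ) →
          ¬ D E.G E.c a (E.p i u) := by
        intro a ha u h1 h2 hd
        rcases h2 with h2 | h2
        · exact Sv.cR a ha i u h2 h1 hd
        · rcases Sv.clC a ha with h3 | h3
          · exact hfarK a h3 i u h1 hd
          · exact h3 i u h2 (Nat.zero_le _) h1 (hd.mono (by omega))
      have F2 : ∀ l, l ≠ i → ∀ a ∈ H l, ∀ u, u ≤ E.n i → (b i ≤ u ∨ X.ρ i < u + E.Λ) →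
          ¬ D E.G E.c a (E.p i u) := by
        intro l hl a ha u h1 h2 hd
        rcases h2 with h2 | h2
        · exact Sv.HR l i hl a ha u h2 h1 hd
        · rcases Sv.clH l i hl a ha with h3 | h3
          · exact hfarK a h3 i u h1 hd
          · exact h3 u h2 h1 (hd.mono (by omega))
      have F3 : ∀ a ∈ H i, ∀ u, τ ≤ u → u ≤ E.n i → ¬ D E.G E.c a (E.p i u) := by
        intro a ha u h1 h2 hd
        rcases Sv.clHH i a ha with h3 | h3
        · exact hfarK a h3 i u h2 hd
        · exact h3 u (by omega) h2 (hd.mono (by omega))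
      refine ⟨H i ∪ Seg E i (min t (b i)) (max t (b i)), Function.update H i (Cv ∪ Q),
        Function.update b i τ, ⟨?_, ?_, ?_, ?_, ?_, ?_, ?_, ?_, ?_, ?_, ?_, ?_, ?_⟩,
        ?_, ?_, ?_, ?_, ?_⟩
      · -- hconn
        intro l
        by_cases hl : l = i
        · subst hl; rw [Function.update_self]; exact hL.conn
        · rw [Function.update_of_ne hl]; exact Sv.hconn l
      · intro l
        by_cases hl : l = i
        · subst hl; rw [Function.update_self]; exact hL.meet
        · rw [Function.update_of_ne hl]; exact Sv.hS l
      · intro l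
        by_cases hl : l = i
        · subst hl; rw [Function.update_self, Function.update_self]; exact Or.inr hL.hy
        · rw [Function.update_of_ne hl, Function.update_of_ne hl]; exact Sv.hb l
      · intro l
        by_cases hl : l = i
        · subst hl; rw [Function.update_self, ρj]
        · rw [Function.update_of_ne hl, ρi l hl]; exact Sv.hbρ l
      · -- cH
        rintro a ha l a' ha'
        rcases mH l a' ha' with ⟨rfl, ha' | ha'⟩ | ⟨hl, ha'⟩
        · rcases ha with ha | ha
          · intro hd; exact Sv.cH a' ha' l a ha hd.symm
          · obtain ⟨u, rfl, h1, h2, h3, h4⟩ := mseg a ha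
            intro hd; exact F1 a' ha' u h2 h3 hd.symm
        · rcases ha with ha | ha
          · intro hd; exact hL.hQH a' ha' l a ha hd.symm
          · obtain ⟨u, rfl, h1, h2, h3, h4⟩ := mseg a ha
            intro hd
            exact qap a' ha' l u h2 (Or.inr (Or.inr h1)) _ (by omega) hd.symm
        · rcases ha with ha | ha
          · exact Sv.HH i l (Ne.symm hl) a ha a' ha'
          · obtain ⟨u, rfl, h1, h2, h3, h4⟩ := mseg a ha
            intro hd; exact F2 l hl a' ha' u h2 h3 hd.symm
      · -- cR
        rintro a ha l t' hb' ht'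
        rcases mb l t' hb' with ⟨rfl, h5, h6⟩ | ⟨hl, h5⟩
        · rcases ha with ha | ha
          · exact F3 a ha t' h5 ht'
          · obtain ⟨u, rfl, h1, h2, h3, h4⟩ := mseg a ha
            intro hd
            exact E.tidy l u t' (by omega) ht' (hd.mono (by omega))
        · rcases ha with ha | ha
          · exact Sv.HR i l (Ne.symm hl) a ha t' h5 ht'
          · obtain ⟨u, rfl, h1, h2, h3, h4⟩ := mseg a ha
            intro hd
            exact E.sep i l u t' (Ne.symm hl) h2 ht' (hd.mono (by omega))
      · -- HH
        have key : ∀ l, l ≠ i → ∀ a ∈ Cv ∪ Q, ∀ a' ∈ H l, ¬ D E.G E.c a a' := by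
          rintro l hl a (ha | ha) a' ha'
          · exact Sv.cH a ha l a' ha'
          · exact hL.hQH a ha l a' ha'
        intro l l' hll a ha a' ha'
        rcases mH l a ha with ⟨e1, ha⟩ | ⟨hl, ha⟩
        · rcases mH l' a' ha' with ⟨e2, ha'⟩ | ⟨hl', ha'⟩
          · exact absurd (e1.trans e2.symm) hll
          · exact key l' hl' a ha a' ha'
        · rcases mH l' a' ha' with ⟨e2, ha'⟩ | ⟨hl', ha'⟩
          · intro hd; exact key l hl a' ha' a ha hd.symm
          · exact Sv.HH l l' hll a ha a' ha'
      · -- HR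
        intro l l' hll a ha t' hb' ht'
        rcases mH l a ha with ⟨e1, ha⟩ | ⟨hl, ha2⟩
        · rcases mb l' t' hb' with ⟨e2, h5, h6⟩ | ⟨hl', h5⟩
          · exact absurd (e1.trans e2.symm) hll
          · rcases ha with ha | ha
            · exact Sv.cR a ha l' t' h5 ht'
            · exact qap a ha l' t' ht' (Or.inl (Ne.symm hl')) _ (by omega)
        · rcases mb l' t' hb' with ⟨rfl, h5, h6⟩ | ⟨hl', h5⟩
          · exact Sv.HR l l' hll a ha2 t' h6 ht'
          · exact Sv.HR l l' hll a ha2 t' h5 ht'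
      · -- gH
        intro l a ha
        rcases mH l a ha with ⟨rfl, ha | ha⟩ | ⟨hl, ha⟩
        · exact (Sv.gC a ha).imp id (fun h => hG _ _ h)
        · exact Or.inr (hgQ a ha)
        · exact (Sv.gH l a ha).imp id (fun h => (hG _ _ h).mono (by omega))
      · -- gC
        rintro a (ha | ha)
        · exact (Sv.gH i a ha).imp id (fun h => (hG _ _ h).mono (by omega))
        · obtain ⟨u, rfl, h1, h2, h3, h4⟩ := mseg a ha
          exact Or.inl ⟨i, u, h2, rfl⟩
      · -- clC
        rintro a (ha | ha)
        · by_cases haK : a ∈ X.K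
          · exact Or.inl (hKK haK)
          · right
            intro l t' h1 h2 h3
            by_cases hl : l = i
            · subst hl
              exact ((Sv.clHH l a ha).resolve_left haK) t' (by omega) h3
            · rw [ρi l hl] at h1
              exact ((Sv.clH i l (Ne.symm hl) a ha).resolve_left haK) t' h1 h3
        · obtain ⟨u, rfl, h1, h2, h3, h4⟩ := mseg a ha
          right
          intro l t' h5 h6 h7 hd
          by_cases hl : l = i
          · subst hl
            have h6 : t + E.Λ ≤ t' := by simpa [thZ] using h6
            exact E.tidy l u t' (by omega) h7 (hd.mono (by omega))
          · exact E.sep i l u t' (Ne.symm hl) h2 h7 (hd.mono (by omega))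
      · -- clH
        intro l l' hll a ha
        rcases mH l a ha with ⟨rfl, ha | ha⟩ | ⟨hl, ha⟩
        · refine (Sv'.clC a ha).imp id ?_
          intro hh t' h1 h2
          exact hh l' t' h1 (Nat.zero_le _) h2
        · right
          intro t' h1 h2
          exact qap a ha l' t' h2 (Or.inl hll) _ le_rfl
        · exact Sv'.clH l l' hll a ha
      · -- clHH
        intro l a ha
        rcases mH l a ha with ⟨rfl, ha | ha⟩ | ⟨hl, ha⟩
        · refine (Sv'.clC a ha).imp id ?_
          intro hh t' h1 h2
          exact hh l t' (by omega) (Nat.zero_le _) h2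
        · right
          intro t' h1 h2
          exact qap a ha l t' h2 (Or.inr (Or.inl (by omega))) _ le_rfl
        · exact Sv'.clHH l a ha
      · exact Or.inr ⟨t, by omega, by omega, rfl⟩
      · refine (Sv.hconn i).union (E.segConn i (by omega) (by omega)) (z := E.p i (b i)) (Sv.hb i) ?_
        exact ⟨b i, by omega, by omega, rfl⟩
      · obtain ⟨s, h1, h2⟩ := Sv.hS i
        exact ⟨s, h1, Or.inl h2⟩
      · intro l a ha hd
        have hd := hd.symm
        rcases mH l a ha with ⟨rfl, ha | ha⟩ | ⟨hl, ha⟩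
        · rcases Sv.clC a ha with h3 | h3
          · exact hX.farR h3 (by omega) (by omega) (by omega) hd
          · exact h3 l t (by omega) (Nat.zero_le _) (by omega) (hd.mono (by omega))
        · exact qap a ha l t (by omega) (Or.inr (Or.inr (by omega))) _ (by omega) hd
        · rcases Sv.clH l i hl a ha with h3 | h3
          · exact hX.farR h3 (by omega) (by omega) (by omega) hd
          · exact h3 t (by omega) (by omega) (hd.mono (by omega))
      · intro l t' hb' ht' hd
        rcases mb l t' hb' with ⟨rfl, h5, h6⟩ | ⟨hl, h5⟩
        · exact E.tidy l t t' (by omega) ht' (hd.mono (by omega))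
        · exact E.sep i l t t' (Ne.symm hl) (by omega) ht' (hd.mono (by omega))
  · -- cn1
    intro i a ha
    by_cases hi : i = j
    · subst hi
      rw [Cj] at ha
      rw [ρj]
      exact hL.hQ a ha
    · rw [Ci i hi] at ha
      rw [ρi i hi]
      exact hX.cn1 i a ha
  · -- cn2
    intro i a ha hup
    by_cases hi : i = j
    · subst hi
      rw [Cj] at ha
      rw [ρj] at hup ⊢
      rw [σj]
      obtain ⟨Q', hQ'Q, haQ', hconn, ⟨s, hs, hsC⟩, hfar⟩ := hL.upper a ha hup
      refine ⟨hfar a haQ', Cv ∪ Q', H, b, Sys.addC (Sv.persist hKK hρρ hMM hG hT0 ?_) ?_ ?_ ?_ ?_,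
        Or.inr haQ', hconn, s, hs, hsC⟩
      · intro l t h _; exact Nat.zero_le _
      · intro a' ha'
        exact hL.hQH a' (hQ'Q ha')
      · intro a' ha' l t _ ht hd
        exact hfar a' ha' l t ht (hd.mono (by omega))
      · intro a' ha'
        exact Or.inr ((hgQ a' (hQ'Q ha')).mono (by omega))
      · intro a' ha'
        right
        intro l t h1 h2 h3 hd
        refine E.ap2 (hL.hQ a' (hQ'Q ha')) hd (by omega) hτn h3 ?_
        by_cases hl : l = i
        · subst hl
          have h2 : τ + E.Λ ≤ t := by simpa [thZ] using h2
          exact Or.inr (Or.inl h2)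
        · exact Or.inl (Ne.symm hl)
    · rw [Ci i hi] at ha
      rw [ρi i hi] at hup ⊢
      rw [σi i hi]
      refine ⟨(hX.cn2 i a ha hup).1, (hX.cn2 i a ha hup).2.persist hKK hρρ hMM hG le_rfl
        (fun _ _ _ h => h)⟩

end CM
open SimpleGraph
set_option linter.unusedVariables false
namespace CM
variable {V : Type} {k : ℕ}

/-- `m` connected sets, each meeting `S` and `T`, pairwise at distance more than `c` -/
def Succ (G : SimpleGraph V) (S T : Set V) (c m : ℕ) : Prop :=
  ∃ Z : Fin m → Set V, (∀ i, Conn G (Z i)) ∧ (∀ i, ∃ s ∈ S, s ∈ Z i) ∧ (∀ i, ∃ t ∈ T, t ∈ Z i) ∧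
    ∀ i j, i ≠ j → ∀ a ∈ Z i, ∀ b ∈ Z j, ¬ D G c a b

theorem success {E : Env V k} {X : Dat V k} (hρ : ∀ i, X.ρ i ≤ E.n i) {τ : ℕ} {θ : Fin k → ℕ}
    {C0 C : Set V} {H : Fin k → Set V} {b : Fin k → ℕ} (hS : Sys E X τ θ C0 H b)
    (hc : Conn E.G C) (h1 : ∃ s ∈ E.S, s ∈ C) (h2 : ∃ t ∈ E.Tg, t ∈ C)
    (h3 : ∀ a ∈ C, ∀ i, ∀ a' ∈ H i, ¬ D E.G E.c a a')
    (h4 : ∀ a ∈ C, ∀ i t, b i ≤ t → t ≤ E.n i → ¬ D E.G E.c a (E.p i t)) :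
    Succ E.G E.S E.Tg E.c (k + 1) := by
  have iq1 := E.iq1
  have iRfar := E.iRfar
  have hbn : ∀ i, b i ≤ E.n i := fun i => (hS.hbρ i).trans (hρ i)
  have hCB : ∀ i, ∀ a ∈ C, ∀ a' ∈ H i ∪ Seg E i (b i) (E.n i), ¬ D E.G E.c a a' := by
    rintro i a ha a' (ha' | ⟨t, h5, h6, rfl⟩)
    · exact h3 a ha i a' ha'
    · exact h4 a ha i t h5 h6
  refine ⟨Fin.cons C (fun i => H i ∪ Seg E i (b i) (E.n i)), ?_, ?_, ?_, ?_⟩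
  · intro i
    refine Fin.cases ?_ (fun i => ?_) i
    · exact hc
    · exact (hS.hconn i).union (E.segConn i (hbn i) le_rfl) (hS.hb i) ⟨b i, le_rfl, hbn i, rfl⟩
  · intro i
    refine Fin.cases ?_ (fun i => ?_) i
    · exact h1
    · obtain ⟨s, a1, a2⟩ := hS.hS i
      exact ⟨s, a1, Or.inl a2⟩
  · intro i
    refine Fin.cases ?_ (fun i => ?_) i
    · exact h2
    · exact ⟨_, E.rT i, Or.inr ⟨E.n i, hbn i, le_rfl, rfl⟩⟩
  · intro i j
    refine Fin.cases ?_ (fun i => ?_) i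
    · refine Fin.cases ?_ (fun j => ?_) j
      · intro h; exact absurd rfl h
      · intro _ a ha a' ha'
        exact hCB j a ha a' ha'
    · refine Fin.cases ?_ (fun j => ?_) j
      · intro _ a ha a' ha' hd
        exact hCB i a' ha' a ha hd.symm
      · intro hij
        have hij : i ≠ j := fun h => hij (by rw [h])
        rintro a (ha | ⟨t, h5, h6, rfl⟩) a' (ha' | ⟨t', h5', h6', rfl⟩)
        · exact hS.HH i j hij a ha a' ha'
        · exact hS.HR i j hij a ha t' h5' h6'
        · intro hd
          exact hS.HR j i (Ne.symm hij) a' ha' t h5 h6 hd.symm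
        · intro hd
          exact E.sep i j t t' hij h6 h6' (hd.mono (by omega))

theorem landK {E : Env V k} {X : Dat V k} (hX : Full E X) {v : V} (hv : v ∈ X.K) {j : Fin k} {t : ℕ}
    (hd : D E.G (E.R + 1) v (E.p j t)) (ht : X.ρ j + 3 * E.Λ ≤ t) (htn : t ≤ E.n j) :
    ∃ T0 Cv Q H b, Land E X j t T0 Cv Q H b := by
  classical
  have iRU' := E.iRU'
  have iRU := E.iRU
  have iRfar := E.iRfar
  have iq1 := E.iq1
  have iΛ := E.iΛ
  have hex : ∃ δ, ∃ v ∈ X.K, D E.G δ v (E.p j t) := ⟨_, v, hv, hd⟩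
  obtain ⟨v', hv', hd'⟩ := Nat.find_spec hex
  have hmin : ∀ δ', ∀ v ∈ X.K, D E.G δ' v (E.p j t) → Nat.find hex ≤ δ' :=
    fun δ' v hv h => Nat.find_min' hex ⟨v, hv, h⟩
  set δ := Nat.find hex
  have hδ := hmin _ v hv hd
  obtain ⟨C, H, b, hS, hvC, hcC, s, hs, hsC⟩ := hX.sysK v' hv'
  obtain ⟨Q, -, hvQ, hyQ, hcQ, hQ⟩ := DK.path hd'
  have hQ1 : ∀ a ∈ Q, D E.G (E.R + 1) a (E.p j t) := by
    intro a ha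
    obtain ⟨i1, i2, h1, h2, h3⟩ := hQ a ha
    exact h3.toD.mono (by omega)
  refine ⟨X.T v', C, Q, H, b, ht, htn, hX.TM v' hv', hS, hyQ, hcC.union hcQ hvC hvQ,
    ⟨s, hs, Or.inl hsC⟩, hQ1, ?_, ?_⟩
  · intro a ha i a' ha' haa
    by_cases hK : a' ∈ X.K
    · obtain ⟨i1, i2, h1, h2, h3⟩ := hQ a ha
      have h4 := hmin _ a' hK (haa.symm.trans h3.toD)
      have h5 : D E.G (2 * E.c) v' a' := (h2.toD.trans haa).mono (by omega)
      rcases hS.gH i a' ha' with ⟨l, t', ht', rfl⟩ | hg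
      · exact farK hX.toCls hX.a1 hK (r := 0) (by omega) ht' D.refl
      · exact lt_irrefl _ (hX.toCls.grd hg hv' h5)
    · have h6 : D E.G E.Rfar a' (E.p j t) := (haa.symm.trans (hQ1 a ha)).mono (by omega)
      by_cases hi : i = j
      · subst hi
        exact (hS.clHH i a' ha').resolve_left hK t (by omega) htn h6
      · exact (hS.clH i j hi a' ha').resolve_left hK t (by omega) htn h6
  · intro a ha hup
    obtain ⟨i1, i2, h1, h2, h3⟩ := hQ a ha
    have hi2 : E.RU < i2 := by
      by_contra hcon
      exact hup (h3.toD.mono (by omega))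
    obtain ⟨Q', hQQ, hvQ', haQ', hcQ', hQ'⟩ := DK.path h2
    refine ⟨Q', hQQ, haQ', hcC.union hcQ' hvC hvQ', ⟨s, hs, Or.inl hsC⟩, ?_⟩
    intro a' ha' l t' ht' hda
    obtain ⟨rfl, h4, h5⟩ := E.ap3 (hQ1 a' (hQQ ha')) hda (by omega) htn ht'
    obtain ⟨e1, e2, g1, g2, g3⟩ := hQ' a' ha'
    exact hX.farR hv' (r := e1 + E.RU') (by omega) ht' (by omega) (g2.toD.trans hda)

theorem landS {E : Env V k} {X : Dat V k} (hX : Full E X) {s : V} (hs : s ∈ E.S) {j : Fin k} {t : ℕ}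
    (hd : D E.G E.R s (E.p j t)) (ht : X.ρ j + 4 * E.Λ ≤ t) (htn : t ≤ E.n j) :
    ∃ τ T0 Cv Q H b, Land E X j τ T0 Cv Q H b := by
  classical
  have iRU' := E.iRU'
  have iRU := E.iRU
  have iRfar := E.iRfar
  have iq1 := E.iq1
  have iΛ := E.iΛ
  have hex : ∃ δ, ∃ l t', t' ≤ E.n l ∧ D E.G δ s (E.p l t') := ⟨_, j, t, htn, hd⟩
  obtain ⟨l, τ, hτn, hd'⟩ := Nat.find_spec hex
  have hmin : ∀ δ', ∀ l t', t' ≤ E.n l → D E.G δ' s (E.p l t') → Nat.find hex ≤ δ' :=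
    fun δ' l t' h1 h => Nat.find_min' hex ⟨l, t', h1, h⟩
  set δ := Nat.find hex
  have hδ := hmin _ j t htn hd
  obtain ⟨rfl, h1, h2⟩ := E.ap3 hd' hd (by omega) hτn htn
  obtain ⟨Q, -, hvQ, hyQ, hcQ, hQ⟩ := DK.path hd'
  have hQ1 : ∀ a ∈ Q, D E.G (E.R + 1) a (E.p l τ) := by
    intro a ha
    obtain ⟨i1, i2, h1, h2, h3⟩ := hQ a ha
    exact h3.toD.mono (by omega)
  refine ⟨τ, 0, ∅, Q, _, _, by omega, hτn, Nat.zero_le _, sys_base E X 0 _, hyQ, ?_, ?_, hQ1, ?_, ?_⟩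
  · rw [Set.empty_union]; exact hcQ
  · rw [Set.empty_union]; exact ⟨s, hs, hvQ⟩
  · rintro a ha i a' rfl haa
    refine E.ap2 (hQ1 a ha) haa (by omega) hτn (Nat.zero_le _) ?_
    right; right; omega
  · intro a ha hup
    obtain ⟨i1, i2, h1, h2, h3⟩ := hQ a ha
    have hi2 : E.RU < i2 := by
      by_contra hcon
      exact hup (h3.toD.mono (by omega))
    obtain ⟨Q', hQQ, hvQ', haQ', hcQ', hQ'⟩ := DK.path h2
    refine ⟨Q', hQQ, haQ', ?_, ?_, ?_⟩
    · rw [Set.empty_union]; exact hcQ'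
    · rw [Set.empty_union]; exact ⟨s, hs, hvQ'⟩
    intro a' ha' l' t' ht' hda
    obtain ⟨e1, e2, g1, g2, g3⟩ := hQ' a' ha'
    have := hmin _ l' t' ht' (g2.toD.trans hda)
    omega

def Blocks (E : Env V k) (ρ : Fin k → ℕ) : Prop :=
  ∀ a ∈ E.S, ∀ b ∈ E.Tg, ∀ r, ¬ DK E.G {v | ∀ i, ¬ D E.G (E.RF + 4 * E.Λ) v (E.p i (ρ i))} r a b

theorem stuck {E : Env V k} {X : Dat V k} (hX : Full E X)
    (hno : ∀ j τ T0 Cv Q H b, ¬ Land E X j τ T0 Cv Q H b)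
    (hns : ¬ Succ E.G E.S E.Tg E.c (k + 1)) : Blocks E X.ρ := by
  have iRU := E.iRU
  have iR1 := E.iR1
  have iRE := E.iRE
  have iR := E.iR
  have iRF := E.iRF
  have iRfar := E.iRfar
  have iq1 := E.iq1
  have iΛ := E.iΛ
  intro a ha b hb r hw
  set Y : Set V := {v | ∀ i, ¬ D E.G (E.RF + 4 * E.Λ) v (E.p i (X.ρ i))} with hY
  -- close to a right row vertex: must be far to the right
  have ball : ∀ v ∈ Y, ∀ i t, t ≤ E.n i → X.ρ i < t + 2 * E.Λ → D E.G E.R v (E.p i t) →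
      X.ρ i + 4 * E.Λ ≤ t := by
    intro v hv i t ht h1 hd
    by_contra hcon
    exact hv i ((hd.trans (E.rowD' i ht (hX.ρn i) (r := 4 * E.Λ) (by omega) (by omega))).mono
      (by omega))
  have out : ∀ v ∈ Y, (∀ i t, t ≤ E.n i → X.ρ i + 4 * E.Λ ≤ t → ¬ D E.G E.R v (E.p i t)) →
      v ∈ Out E X.ρ ∨ ∃ j t, t + 2 * E.Λ ≤ X.ρ j ∧ D E.G E.R1 v (E.p j t) := by
    intro v hv hr
    by_cases hz : ∃ j t, t + 2 * E.Λ ≤ X.ρ j ∧ D E.G E.R1 v (E.p j t)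
    · exact Or.inr hz
    · left
      have h2 : ∀ i t, t ≤ E.n i → X.ρ i < t + 2 * E.Λ → ¬ D E.G E.R v (E.p i t) :=
        fun i t ht h1 hd => hr i t ht (ball v hv i t ht h1 hd) hd
      refine ⟨?_, h2, ?_⟩
      · intro i t ht hd
        by_cases h : t + 2 * E.Λ ≤ X.ρ i
        · exact hz ⟨i, t, h, hd⟩
        · exact h2 i t ht (by omega) (hd.mono (by omega))
      · intro i hd
        exact hv i (hd.mono (by omega))
  have key : (b ∈ X.K ∧ b ∈ Out E X.ρ) ∨ ∃ j t, t + 2 * E.Λ ≤ X.ρ j ∧ D E.G E.R1 b (E.p j t) := by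
    refine hw.prop (P := fun v => (v ∈ X.K ∧ v ∈ Out E X.ρ) ∨
      ∃ j t, t + 2 * E.Λ ≤ X.ρ j ∧ D E.G E.R1 v (E.p j t)) ?_ ?_
    · rintro v v' hv hv' hadj (⟨h1, h2⟩ | ⟨j, t, h1, h2⟩)
      · have hh : ∀ i t, t ≤ E.n i → X.ρ i + 4 * E.Λ ≤ t → ¬ D E.G E.R v' (E.p i t) := by
          intro i t ht h4 hd
          obtain ⟨T0, Cv, Q, H, b', hL⟩ := landK hX h1 (((D.adj hadj).trans hd).mono (by omega))
            (by omega) ht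
          exact hno _ _ _ _ _ _ _ hL
        rcases out v' hv' hh with h3 | h3
        · exact Or.inl ⟨hX.f7b v h1 v' h3 hadj, h3⟩
        · exact Or.inr h3
      · have h5 : D E.G E.RE v' (E.p j t) := ((D.adj hadj).symm.trans h2).mono (by omega)
        have hh : ∀ i t, t ≤ E.n i → X.ρ i + 4 * E.Λ ≤ t → ¬ D E.G E.R v' (E.p i t) := by
          intro i t' ht' h4 hd
          have := hX.ρn j
          obtain ⟨rfl, h6, h7⟩ := E.ap3 h5 hd (by omega) (by omega) ht'
          omega
        rcases out v' hv' hh with h3 | h3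
        · exact Or.inl ⟨hX.f7c v' h3 j t h1 h5, h3⟩
        · exact Or.inr h3
    · have hh : ∀ i t, t ≤ E.n i → X.ρ i + 4 * E.Λ ≤ t → ¬ D E.G E.R a (E.p i t) := by
        intro i t ht h4 hd
        obtain ⟨τ, T0, Cv, Q, H, b', hL⟩ := landS hX ha hd h4 ht
        exact hno _ _ _ _ _ _ _ hL
      rcases out a hw.left hh with h3 | h3
      · exact Or.inl ⟨hX.f7a a ha h3, h3⟩
      · exact Or.inr h3
  rcases key with ⟨h1, -⟩ | ⟨j, t, h1, h2⟩
  · obtain ⟨C, H, b', hS, hvC, hcC, hs⟩ := hX.sysK b h1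
    exact hns (success hX.ρn hS hcC hs ⟨b, hb, hvC⟩ hS.cH hS.cR)
  · obtain ⟨C, H, b', hS, hvC, hcC, ⟨s, hs, hsC⟩, hF⟩ := hX.sysZ j t (by omega)
    obtain ⟨Q, -, hzQ, hbQ, hcQ, hQ⟩ := DK.path h2.symm
    have hQR : ∀ a ∈ Q, D E.G E.RE (E.p j t) a := by
      intro a ha
      obtain ⟨i1, i2, hi, hi1, hi2⟩ := hQ a ha
      exact hi1.toD.mono (by omega)
    refine hns (success hX.ρn hS (hcC.union hcQ hvC hzQ) ⟨s, hs, Or.inl hsC⟩ ⟨b, hb, Or.inr hbQ⟩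
      ?_ ?_)
    · rintro a (ha | ha)
      · exact hS.cH a ha
      · exact (geo_far hF (hQR a ha)).1
    · rintro a (ha | ha)
      · exact hS.cR a ha
      · exact (geo_far hF (hQR a ha)).2

theorem loop [Finite V] (E : Env V k) (hns : ¬ Succ E.G E.S E.Tg E.c (k + 1)) :
    ∀ (m : ℕ) (X : Dat V k), Full E X → ∑ i, (E.n i - X.ρ i) = m → ∃ ρ : Fin k → ℕ, Blocks E ρ := by
  intro m
  induction m using Nat.strong_induction_on with
  | _ m ih =>
    intro X hX hm
    by_cases hno : ∀ j τ T0 Cv Q H b, ¬ Land E X j τ T0 Cv Q H b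
    · exact ⟨X.ρ, stuck hX hno hns⟩
    · push Not at hno
      obtain ⟨j, τ, T0, Cv, Q, H, b, hL⟩ := hno
      obtain ⟨X1, hρ1, hX1⟩ := landing hX hL
      obtain ⟨X2, hρ2, hX2⟩ := completion hX1
      refine ih _ ?_ X2 hX2 rfl
      rw [← hm, hρ2, hρ1]
      have h1 := hL.hτ
      have h2 := hL.hτn
      have h3 := E.iΛ
      refine Finset.sum_lt_sum ?_ ⟨j, Finset.mem_univ _, ?_⟩
      · intro i _
        by_cases hi : i = j
        · subst hi; rw [Function.update_self]; omega
        · rw [Function.update_of_ne hi]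
      · rw [Function.update_self]; omega

theorem main_env [Finite V] (E : Env V k) :
    Succ E.G E.S E.Tg E.c (k + 1) ∨ ∃ ρ : Fin k → ℕ, Blocks E ρ := by
  by_cases hns : Succ E.G E.S E.Tg E.c (k + 1)
  · exact Or.inl hns
  · right
    have iΛ := E.iΛ
    have h0 : Pre E ⟨fun _ => 0, ∅, ∅, fun _ => 0, fun _ _ => 0, fun _ => ∅, fun _ => 0, 0⟩ := by
      refine ⟨fun i => Nat.zero_le _, Inv.self, ?_, ?_, ?_, ?_, ?_, ?_, ?_, ?_, ?_⟩
      · intro v hv; exact absurd hv (Set.notMem_empty _)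
      · intro j t; exact le_rfl
      · intro j; exact le_rfl
      · intro v hv; exact absurd hv (Set.notMem_empty _)
      · intro v hv; exact absurd hv (Set.notMem_empty _)
      · intro v hv; exact absurd hv (Set.notMem_empty _)
      · intro j t h
        have h : t + E.Λ ≤ 0 := h
        omega
      · intro i v hv; exact absurd hv (Set.notMem_empty _)
      · intro i v hv; exact absurd hv (Set.notMem_empty _)
    obtain ⟨X, -, hX⟩ := completion h0
    exact loop E hns _ X hX rfl

end CM
open SimpleGraph

set_option linter.unusedVariables false

namespace CM

theorem noRS {V : Type} {G : SimpleGraph V} {d n : ℕ} {W : Fin n → Finset V}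
    (hW : ∀ i, (W i).card ≤ d + 1)
    (hV : ∀ v : V, ∃ i, v ∈ W i)
    (hE : ∀ u v : V, G.Adj u v → ∃ i, u ∈ W i ∧ v ∈ W i)
    (hI : ∀ i j l : Fin n, i ≤ j → j ≤ l → ∀ v : V, v ∈ W i → v ∈ W l → v ∈ W j) :
    ∀ T v, ¬ RS G (2 * (d + 1)) T v := by
  intro T v h
  obtain ⟨i, F, hF, -, hc⟩ := RS.bag hV hE hI _ T v h
  have := Finset.card_le_card hF
  have := hW i
  omega

theorem row {V : Type} [Finite V] {G : SimpleGraph V} {N q : ℕ} (hN : ∀ T v, ¬ RS G N T v)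
    (hN0 : 0 < N) {Z : Set V} (hZ : Conn G Z) {s t : V} (hs : s ∈ Z) (ht : t ∈ Z) :
    ∃ (n : ℕ) (p : ℕ → V), (∀ j, j < n → G.Adj (p j) (p (j + 1))) ∧ p 0 = s ∧ p n = t ∧
      (∀ j, ∃ z ∈ Z, D G (q * N) (p j) z) ∧
      ∀ j j', j + ((2 * q * N + 1) * q + 1) ≤ j' → j' ≤ n → ¬ D G q (p j) (p j') := by
  classical
  obtain ⟨K, hZK, -, h1, h2⟩ := hull (q := q) hN hN0 (Inv.self (G := G) (A := Z))
  have hex : ∃ r, DK G K r s t := by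
    obtain ⟨r, hr⟩ := hZ s hs t ht
    exact ⟨r, hr.mono le_rfl hZK⟩
  obtain ⟨w, hw1, hw2⟩ := Nat.find_spec hex
  have hmin : ∀ r, DK G K r s t → w.length ≤ r := fun r hr => hw1.trans (Nat.find_min' hex hr)
  refine ⟨w.length, w.getVert, ?_, by simp, by simp, ?_, ?_⟩
  · intro j hj; exact w.adj_getVert_succ hj
  · intro j
    obtain ⟨z, hz, hd⟩ := h2 _ (hw2 _ (w.getVert_mem_support j))
    exact ⟨z, hz, hd.toD⟩
  · intro j j' hjj hj' hd
    have hk := h1 _ (hw2 _ (w.getVert_mem_support j)) _ (hw2 _ (w.getVert_mem_support j')) q le_rfl hd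
    have ha : DK G K j s (w.getVert j) :=
      ⟨w.take j, by rw [Walk.take_length]; omega,
        fun z hz => hw2 _ ((w.isSubwalk_take j).support_subset hz)⟩
    have hb : DK G K (w.length - j') (w.getVert j') t :=
      ⟨w.drop j', by rw [Walk.drop_length],
        fun z hz => hw2 _ ((w.isSubwalk_drop j').support_subset hz)⟩
    have := hmin _ ((ha.trans hk).trans hb)
    omega

theorem step {k : ℕ} (d c : ℕ) : ∃ q ℓ : ℕ, ∀ (V : Type) [Finite V] (G : SimpleGraph V)
    (_ : ∀ T v, ¬ RS G (2 * (d + 1)) T v) (S T : Set V), Succ G S T q k →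
    Succ G S T c (k + 1) ∨ ∃ X : Finset V, X.card ≤ k ∧
      ∀ a ∈ S, ∀ b ∈ T, ∀ r, ¬ DK G {v | ∀ x ∈ X, ¬ D G ℓ v x} r a b := by
  classical
  obtain ⟨N, hNd⟩ : ∃ N, N = 2 * (d + 1) := ⟨_, rfl⟩
  obtain ⟨h, hh⟩ : ∃ x, x = (4 * c) * N := ⟨_, rfl⟩
  obtain ⟨L1, hL1⟩ : ∃ x, x = (2 * (4 * c) * N + 1) * (4 * c) := ⟨_, rfl⟩
  obtain ⟨W, hW⟩ : ∃ x, x = h + 2 * c := ⟨_, rfl⟩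
  obtain ⟨RU', hRU'⟩ : ∃ x, x = h + 2 * c + 1 := ⟨_, rfl⟩
  obtain ⟨RU, hRU⟩ : ∃ x, x = RU' + h + 1 := ⟨_, rfl⟩
  obtain ⟨R1, hR1⟩ : ∃ x, x = W + RU := ⟨_, rfl⟩
  obtain ⟨RE, hRE⟩ : ∃ x, x = R1 + 1 := ⟨_, rfl⟩
  obtain ⟨R, hR⟩ : ∃ x, x = h + RE + c + 1 := ⟨_, rfl⟩
  obtain ⟨RF, hRF⟩ : ∃ x, x = W + R + 1 := ⟨_, rfl⟩
  obtain ⟨Rfar, hRfar⟩ : ∃ x, x = R + 1 + RE + 2 * c := ⟨_, rfl⟩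
  obtain ⟨q1, hq1⟩ : ∃ x, x = 2 * Rfar + RE + 2 * R + W + RU + 10 := ⟨_, rfl⟩
  obtain ⟨Λ, hΛ⟩ : ∃ x, x = (2 * q1 * N + 1) * q1 + 1 := ⟨_, rfl⟩
  refine ⟨q1 * N + q1 + q1 * N, RF + 4 * Λ, ?_⟩
  intro V _ G hN S T ⟨Z, hZ, hZS, hZT, hsep⟩
  rw [← hNd] at hN
  have hN0 : 0 < N := by omega
  choose s hsS hsZ using hZS
  choose t htT htZ using hZT
  choose n p r1 r2 r3 r4 r5 using fun i => row (q := q1) hN hN0 (hZ i) (hsZ i) (htZ i)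
  let E : Env V k :=
    { G := G, S := S, Tg := T, p := p, n := n, c := c, N := N, h := h, L1 := L1, β := L1 + h + 1
      W := W, RU' := RU', RU := RU, R1 := R1, RE := RE, R := R, RF := RF, Rfar := Rfar, q1 := q1
      Λ := Λ, hN := hN, hN0 := hN0, iL1 := hL1.ge, ih := hh.ge, iβ1 := by omega, iβ2 := by omega
      iW := hW.ge, iRU' := hRU'.ge, iRU := hRU.ge, iR1 := hR1.ge, iRE := hRE.ge, iR := hR.ge
      iRF := hRF.ge, iRfar := hRfar.ge, iq1 := hq1.ge, iΛ := by omega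
      radj := r1
      rS := fun i => by rw [r2]; exact hsS i
      rT := fun i => by rw [r3]; exact htT i
      tidy := fun i t t' h1 h2 => r5 i t t' (by rw [← hΛ]; exact h1) h2
      sep := by
        intro i j t t' hij _ _ hd
        obtain ⟨z, hz, hzd⟩ := r4 i t
        obtain ⟨z', hz', hzd'⟩ := r4 j t'
        exact hsep i j hij z hz z' hz' ((hzd.symm.trans hd).trans hzd') }
  rcases main_env E with h1 | ⟨ρ, h1⟩
  · exact Or.inl h1
  · right
    refine ⟨Finset.univ.image (fun i => p i (ρ i)), ?_, ?_⟩
    · exact Finset.card_image_le.trans (by simp)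
    · intro a ha b hb r hd
      refine h1 a ha b hb r (hd.mono le_rfl ?_)
      intro v hv i
      exact hv _ (Finset.mem_image_of_mem _ (Finset.mem_univ i))

theorem F (k d : ℕ) : ∀ c, ∃ ℓ : ℕ, ∀ (V : Type) [Finite V] (G : SimpleGraph V)
    (_ : ∀ T v, ¬ RS G (2 * (d + 1)) T v) (S T : Set V),
    Succ G S T c (k + 1) ∨ ∃ X : Finset V, X.card ≤ k ∧
      ∀ a ∈ S, ∀ b ∈ T, ∀ r, ¬ DK G {v | ∀ x ∈ X, ¬ D G ℓ v x} r a b := by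
  induction k with
  | zero =>
    intro c
    obtain ⟨q, ℓ, h⟩ := step (k := 0) d c
    refine ⟨ℓ, fun V _ G hG S T => h V G hG S T ?_⟩
    exact ⟨fun i => i.elim0, fun i => i.elim0, fun i => i.elim0, fun i => i.elim0,
      fun i => i.elim0⟩
  | succ k ih =>
    intro c
    obtain ⟨q, ℓ, h⟩ := step (k := k + 1) d c
    obtain ⟨ℓ', h'⟩ := ih q
    refine ⟨ℓ + ℓ', fun V _ G hG S T => ?_⟩
    rcases h' V G hG S T with h1 | ⟨X, h1, h2⟩
    · rcases h V G hG S T h1 with h3 | ⟨X, h3, h4⟩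
      · exact Or.inl h3
      · refine Or.inr ⟨X, h3, fun a ha b hb r hd => h4 a ha b hb r (hd.mono le_rfl ?_)⟩
        intro v hv x hx hd'
        exact hv x hx (hd'.mono (by omega))
    · refine Or.inr ⟨X, by omega, fun a ha b hb r hd => h2 a ha b hb r (hd.mono le_rfl ?_)⟩
      intro v hv x hx hd'
      exact hv x hx (hd'.mono (by omega))

end CM
/-- Coarse Menger for graphs of bounded path-width. -/
theorem coarseMenger_of_pathwidth (k d c : ℕ) (hc : 1 ≤ c) :
    ∃ ℓ : ℕ, ∀ (V : Type) [Fintype V], ∀ G : SimpleGraph V, PathwidthAtMost G d →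
      ∀ S T : Set V,
        (∃ (u v : Fin (k + 1) → V) (P : ∀ i, G.Walk (u i) (v i)),
          (∀ i, (P i).IsPath) ∧ (∀ i, u i ∈ S) ∧ (∀ i, v i ∈ T) ∧
          (∀ i j, i ≠ j →
            (c : ℕ∞) ≤ eSetDist G {x | x ∈ (P i).support} {x | x ∈ (P j).support})) ∨
        (∃ X : Finset V, X.card ≤ k ∧
          ∀ (a b : V) (w : G.Walk a b), w.IsPath → a ∈ S → b ∈ T →
            ∃ y ∈ w.support, ∃ x ∈ X, eSetDist G {y} {x} ≤ (ℓ : ℕ∞)) := by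
  classical
  obtain ⟨ℓ, h⟩ := CM.F k d c
  refine ⟨ℓ, ?_⟩
  intro V _ G hG S T
  obtain ⟨n, W, hW, hV, hE, hI⟩ := hG
  rcases h V G (CM.noRS hW hV hE hI) S T with ⟨Z, h1, h2, h3, h4⟩ | ⟨X, h1, h2⟩
  · left
    choose s hsS hsZ using h2
    choose t htT htZ using h3
    choose r w hw1 hw2 using fun i => h1 i (s i) (hsZ i) (t i) (htZ i)
    refine ⟨s, t, fun i => (w i).bypass, fun i => (w i).bypass_isPath, hsS, htT, ?_⟩
    intro i j hij
    refine le_sInf ?_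
    rintro _ ⟨a, b, u, ha, hb, rfl⟩
    by_contra hlt
    rw [not_le, Nat.cast_lt] at hlt
    exact h4 i j hij a (hw2 i _ ((w i).support_bypass_subset_support ha)) b
      (hw2 j _ ((w j).support_bypass_subset_support hb)) ⟨u, hlt.le, fun _ _ => Set.mem_univ _⟩
  · right
    refine ⟨X, h1, ?_⟩
    intro a b w _ ha hb
    by_contra hcon
    refine h2 a ha b hb w.length ⟨w, le_rfl, ?_⟩
    intro y hy x hx hd
    apply hcon
    obtain ⟨u, hu, -⟩ := hd
    refine ⟨y, hy, x, hx, ?_⟩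
    have h5 : eSetDist G {y} {x} ≤ (u.length : ℕ∞) := sInf_le ⟨y, x, u, rfl, rfl, rfl⟩
    exact h5.trans (by exact_mod_cast hu)
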